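/- Let F_q have odd characteristic, d ≥ 3, and t ∈ F_q^*. For any set A ⊆ F_q^d with |A| = αq^d, the number of ordered pairs (x, y) ∈ A × A with |x − y|² = t equals α²q^{2d−1} + O(α q^{(3d−1)/2}); in particular, if α ≥ C q^{-(d−1)/2} for a sufficiently large absolute constant C, then A contains two points x ≠ y with |x − y|² = t. -/

import Mathlib

section Stepanov
open Finset Polynomial

variable {F : Type} [Field F] [Fintype F] {L : Type} [Field L] [Algebra F L]

/-- Points of the Artin-Schreier curve `y^q = y + a x + b / x + c` with `x ≠ 0`. -/
abbrev ASPt (L : Type) [Field L] [Algebra F L] (a b c : F) : Type :=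
  {p : L × L // p.1 ≠ 0 ∧ p.2 ^ Fintype.card F =
    p.2 + algebraMap F L a * p.1 + algebraMap F L b * p.1⁻¹ + algebraMap F L c}

/-- The function `x^(N / q) y^(N % q)`. -/
def asFun (L : Type) [Field L] [Algebra F L] (a b c : F) (N : ℕ) : ASPt L a b c → L :=
  fun p => p.1.1 ^ (N / Fintype.card F) * p.1.2 ^ (N % Fintype.card F)

/-- Span of the functions of pole order `< n`. -/
def asV (L : Type) [Field L] [Algebra F L] (a b c : F) (n : ℕ) :
    Submodule F (ASPt L a b c → L) :=
  Submodule.span F (asFun L a b c '' {N | N < n ∧ (N = 0 ∨ Fintype.card F ≤ N)})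

variable {a b c : F}

lemma asV_mono {n n' : ℕ} (h : n ≤ n') : asV L a b c n ≤ asV L a b c n' :=
  Submodule.span_mono (Set.image_mono fun _ hN => ⟨hN.1.trans_le h, hN.2⟩)

lemma asFun_mem {N n : ℕ} (h : N < n) (h' : N = 0 ∨ Fintype.card F ≤ N) :
    asFun L a b c N ∈ asV L a b c n :=
  Submodule.subset_span ⟨N, ⟨h, h'⟩, rfl⟩

/-- monomials written with explicit exponents -/
lemma asFun_eq (i j : ℕ) (hj : j < Fintype.card F) :
    asFun L a b c (Fintype.card F * i + j) = fun p => p.1.1 ^ i * p.1.2 ^ j := by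
  funext p
  have hq : 0 < Fintype.card F := Fintype.card_pos
  simp only [asFun]
  rw [Nat.mul_add_div hq, Nat.div_eq_of_lt hj, Nat.mul_add_mod, Nat.mod_eq_of_lt hj, add_zero]

lemma asFun_zero : asFun L a b c 0 = 1 := by
  funext p; simp [asFun]

lemma asFun_mul {N N' : ℕ} (h : N = 0 ∨ Fintype.card F ≤ N)
    (h' : N' = 0 ∨ Fintype.card F ≤ N') (ha : a ≠ 0) :
    ∃ κ : F, κ ≠ 0 ∧
      asFun L a b c N * asFun L a b c N' - κ • asFun L a b c (N + N') ∈ asV L a b c (N + N') := by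
  rcases h with rfl | h
  · exact ⟨1, one_ne_zero, by simp [asFun_zero]⟩
  rcases h' with rfl | h'
  · exact ⟨1, one_ne_zero, by simp [asFun_zero]⟩
  set q := Fintype.card F with hq
  have hq0 : 0 < q := Fintype.card_pos
  obtain ⟨i, j, hj, rfl⟩ : ∃ i j, j < q ∧ N = q * i + j :=
    ⟨N / q, N % q, Nat.mod_lt _ hq0, (Nat.div_add_mod N q).symm⟩
  obtain ⟨i', j', hj', rfl⟩ : ∃ i j, j < q ∧ N' = q * i + j :=
    ⟨N' / q, N' % q, Nat.mod_lt _ hq0, (Nat.div_add_mod N' q).symm⟩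
  have hi : i ≠ 0 := by rintro rfl; omega
  have hi' : i' ≠ 0 := by rintro rfl; omega
  obtain ⟨u, rfl⟩ := Nat.exists_eq_succ_of_ne_zero hi
  obtain ⟨u', rfl⟩ := Nat.exists_eq_succ_of_ne_zero hi'
  by_cases hlt : j + j' < q
  · refine ⟨1, one_ne_zero, ?_⟩
    have e : q * (u.succ) + j + (q * (u'.succ) + j') = q * (u.succ + u'.succ) + (j + j') := by ring
    rw [e, asFun_eq _ _ hj, asFun_eq _ _ hj', asFun_eq _ _ hlt, one_smul]
    convert Submodule.zero_mem _ using 1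
    funext p
    simp only [Pi.sub_apply, Pi.mul_apply, Pi.zero_apply]
    ring
  · refine ⟨a, ha, ?_⟩
    obtain ⟨k, hk⟩ : ∃ k, j + j' = q + k := ⟨j + j' - q, by omega⟩
    have hkq : k + 1 < q := by omega
    have e : q * (u.succ) + j + (q * (u'.succ) + j') = q * (u + u' + 3) + k := by
      simp only [Nat.succ_eq_add_one]
      linear_combination hk
    have key : asFun L a b c (q * u.succ + j) * asFun L a b c (q * u'.succ + j')
        - a • asFun L a b c (q * (u + u' + 3) + k)
        = asFun L a b c (q * (u + u' + 2) + (k + 1)) + c • asFun L a b c (q * (u + u' + 2) + k)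
          + b • asFun L a b c (q * (u + u' + 1) + k) := by
      rw [asFun_eq _ _ hj, asFun_eq _ _ hj', asFun_eq _ _ (by omega : k < _),
        asFun_eq _ _ hkq, asFun_eq _ _ (by omega : k < _), asFun_eq _ _ (by omega : k < _)]
      funext p
      obtain ⟨⟨x, y⟩, hx, hy⟩ := p
      simp only [Pi.sub_apply, Pi.mul_apply, Pi.add_apply, Pi.smul_apply]
      simp only [Algebra.smul_def]
      dsimp only at hx hy
      have e1 : x ^ u.succ * y ^ j * (x ^ u'.succ * y ^ j')
          = x ^ (u + u' + 2) * y ^ k * y ^ q := by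
        calc _ = x ^ (u + u' + 2) * y ^ (j + j') := by simp only [Nat.succ_eq_add_one]; ring
          _ = _ := by rw [hk]; ring
      rw [e1, hy]
      field_simp
      ring
    rw [e, key]
    refine Submodule.add_mem _ (Submodule.add_mem _ (asFun_mem ?_ ?_)
      (Submodule.smul_mem _ _ (asFun_mem ?_ ?_))) (Submodule.smul_mem _ _ (asFun_mem ?_ ?_))
    · nlinarith
    · right; nlinarith
    · nlinarith
    · right; nlinarith
    · nlinarith
    · right; nlinarith

lemma asV_mul (ha : a ≠ 0) {n n' : ℕ} {f g : ASPt L a b c → L} (hf : f ∈ asV L a b c n)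
    (hg : g ∈ asV L a b c (n' + 1)) : f * g ∈ asV L a b c (n + n') := by
  unfold asV at hf hg
  induction hf using Submodule.span_induction with
  | zero => simp
  | add x y _ _ hx hy => rw [add_mul]; exact Submodule.add_mem _ hx hy
  | smul r x _ hx => rw [smul_mul_assoc]; exact Submodule.smul_mem _ _ hx
  | mem x hx =>
    obtain ⟨N, ⟨hN, hN'⟩, rfl⟩ := hx
    induction hg using Submodule.span_induction with
    | zero => simp
    | add x y _ _ hx hy => rw [mul_add]; exact Submodule.add_mem _ hx hy
    | smul r x _ hx => rw [mul_smul_comm]; exact Submodule.smul_mem _ _ hx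
    | mem x hx =>
      obtain ⟨M, ⟨hM, hM'⟩, rfl⟩ := hx
      obtain ⟨κ, -, h⟩ := asFun_mul (L := L) (b := b) (c := c) hN' hM' ha
      have h2 : κ • asFun L a b c (N + M) ∈ asV L a b c (n + n') :=
        Submodule.smul_mem _ _ (asFun_mem (by omega) (by omega))
      have := Submodule.add_mem _ (asV_mono (by omega : N + M ≤ n + n') h) h2
      simpa using this

/-- `f` has exact pole order `N`. -/
def ASLead (L : Type) [Field L] [Algebra F L] (a b c : F) (f : ASPt L a b c → L) (N : ℕ) : Prop :=
  (N = 0 ∨ Fintype.card F ≤ N) ∧ ∃ κ : F, κ ≠ 0 ∧ f - κ • asFun L a b c N ∈ asV L a b c N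

lemma asLead_fun {N : ℕ} (h : N = 0 ∨ Fintype.card F ≤ N) :
    ASLead L a b c (asFun L a b c N) N := ⟨h, 1, one_ne_zero, by simp⟩

lemma ASLead.mem {f : ASPt L a b c → L} {N : ℕ} (h : ASLead L a b c f N) :
    f ∈ asV L a b c (N + 1) := by
  obtain ⟨h, κ, -, hk⟩ := h
  have := Submodule.add_mem _ (asV_mono (Nat.le_succ N) hk)
    (Submodule.smul_mem _ κ (asFun_mem (L := L) (a := a) (b := b) (c := c) (Nat.lt_succ_self N) h))
  simpa using this

lemma ASLead.mul (ha : a ≠ 0) {f g : ASPt L a b c → L} {N M : ℕ} (hf : ASLead L a b c f N)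
    (hg : ASLead L a b c g M) : ASLead L a b c (f * g) (N + M) := by
  have hgm := hg.mem
  obtain ⟨h1, κ, hκ, hk⟩ := hf
  obtain ⟨h2, κ', hκ', hk'⟩ := hg
  obtain ⟨κ'', hκ'', hk''⟩ := asFun_mul (L := L) (b := b) (c := c) h1 h2 ha
  refine ⟨by omega, κ * κ' * κ'', by simp [*], ?_⟩
  have e1 := asV_mul ha hk hgm
  have e2 := asV_mul ha hk' (asLead_fun (L := L) (a := a) (b := b) (c := c) h1).mem
  rw [add_comm M N] at e2
  have := Submodule.add_mem _ (Submodule.add_mem _ e1 (Submodule.smul_mem _ κ e2))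
    (Submodule.smul_mem _ (κ * κ') hk'')
  convert this using 1
  funext p
  simp only [Pi.sub_apply, Pi.mul_apply, Pi.add_apply, Algebra.smul_def, map_mul]
  ring

lemma ASLead.pow (ha : a ≠ 0) {f : ASPt L a b c → L} {N : ℕ} (hf : ASLead L a b c f N) (k : ℕ) :
    ASLead L a b c (f ^ k) (k * N) := by
  induction k with
  | zero => simpa [asFun_zero] using asLead_fun (L := L) (a := a) (b := b) (c := c) (N := 0) (Or.inl rfl)
  | succ k ih => rw [pow_succ, add_mul, one_mul]; exact ih.mul ha hf

lemma sum_range_mul_aux {M : Type*} [AddCommMonoid M] (f : ℕ → M) (q l : ℕ) :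
    ∑ N ∈ range (q * l), f N = ∑ j ∈ range q, ∑ i ∈ range l, f (q * i + j) := by
  rw [Finset.sum_comm]
  induction l with
  | zero => simp
  | succ l ih => rw [mul_add, mul_one, Finset.sum_range_add, ih, Finset.sum_range_succ]

/-- a combination of monomials vanishing above many `x` is trivial -/
lemma as_indep [IsAlgClosed L] (e : ℕ → F) (l : ℕ) (X : Finset L) (hX0 : ∀ x ∈ X, x ≠ 0)
    (hX : l ≤ X.card)
    (hv : ∀ p : ASPt L a b c, p.1.1 ∈ X →
      ∑ N ∈ range (Fintype.card F * l), algebraMap F L (e N) * asFun L a b c N p = 0) :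
    ∀ N < Fintype.card F * l, e N = 0 := by
  classical
  set q := Fintype.card F with hq
  have hq1 : 1 < q := Fintype.one_lt_card
  -- coefficient polynomials
  let h : ℕ → L[X] := fun j => ∑ i ∈ range l, C (algebraMap F L (e (q * i + j))) * Polynomial.X ^ i
  have hdeg : ∀ j, (h j).degree < l := fun j => by
    refine (degree_sum_le _ _).trans_lt ?_
    rw [Finset.sup_lt_iff (WithBot.bot_lt_coe _)]
    intro i hi
    exact (degree_C_mul_X_pow_le _ _).trans_lt (by exact_mod_cast mem_range.1 hi)
  have hroot : ∀ x ∈ X, ∀ j < q, (h j).eval x = 0 := by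
    intro x hx
    let z : L := algebraMap F L a * x + algebraMap F L b * x⁻¹ + algebraMap F L c
    let A : L[X] := Polynomial.X ^ q - Polynomial.X - C z
    have hAd : A.natDegree = q := by
      have : A = Polynomial.X ^ q - (Polynomial.X + C z) := by simp only [A]; ring
      rw [this, natDegree_sub_eq_left_of_natDegree_lt] <;> simp
      exact hq1
    have hA0 : A ≠ 0 := by rintro h0; rw [h0] at hAd; simp at hAd; omega
    have hq0 : ((q : ℕ) : L) = 0 := by
      have : ((q : ℕ) : F) = 0 := FiniteField.cast_card_eq_zero F
      rw [← map_natCast (algebraMap F L), this, map_zero]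
    have hsep : A.Separable := by
      have : derivative A = -1 := by simp [A, derivative_X_pow, hq0]
      rw [Polynomial.Separable, this]
      exact ⟨0, -1, by simp⟩
    let B : L[X] := ∑ j ∈ range q, C ((h j).eval x) * Polynomial.X ^ j
    have hBdeg : B.degree < q := by
      refine (degree_sum_le _ _).trans_lt ?_
      rw [Finset.sup_lt_iff (WithBot.bot_lt_coe _)]
      intro i hi
      exact (degree_C_mul_X_pow_le _ _).trans_lt (by exact_mod_cast mem_range.1 hi)
    have hB : B = 0 := by
      refine Polynomial.eq_zero_of_degree_lt_of_eval_finset_eq_zero A.roots.toFinset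
        (hBdeg.trans_le ?_) ?_
      · have : A.roots.toFinset.card = q := by
          rw [Multiset.toFinset_card_of_nodup (nodup_roots hsep), 
            ← hAd, (IsAlgClosed.splits A).natDegree_eq_card_roots]
        rw [this]
      · intro y hy
        have hy' : A.eval y = 0 := by simpa [hA0] using hy
        have hy2 : y ^ q = y + algebraMap F L a * x + algebraMap F L b * x⁻¹ + algebraMap F L c := by
          simp only [A, eval_sub, eval_pow, eval_X, eval_C, z] at hy'
          linear_combination hy'
        have := hv ⟨(x, y), hX0 x hx, hy2⟩ hx
        rw [sum_range_mul_aux] at this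
        rw [← this]
        simp only [B, h, eval_finsetSum, eval_mul, eval_C, eval_pow, eval_X, Finset.sum_mul]
        refine Finset.sum_congr rfl fun j hj => Finset.sum_congr rfl fun i _ => ?_
        rw [asFun_eq _ _ (mem_range.1 hj), mul_assoc]
    intro j hj
    have := congrArg (fun P => P.coeff j) hB
    simpa [B, coeff_X_pow, hj] using this
  intro N hN
  have hj : N % q < q := Nat.mod_lt _ (by omega)
  have hz : h (N % q) = 0 := by
    refine Polynomial.eq_zero_of_degree_lt_of_eval_finset_eq_zero X
      ((hdeg _).trans_le (by exact_mod_cast hX)) (fun x hx => hroot x hx _ hj)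
  have := congrArg (fun P => P.coeff (N / q)) hz
  have hl : N / q < l := Nat.div_lt_of_lt_mul hN
  simpa [h, coeff_X_pow, hl, Nat.div_add_mod] using this



lemma asV_exists {n : ℕ} {f : ASPt L a b c → L} (hf : f ∈ asV L a b c n) :
    ∃ e : ℕ → F, f = ∑ N ∈ range n, e N • asFun L a b c N := by
  unfold asV at hf
  induction hf using Submodule.span_induction with
  | zero => exact ⟨0, by simp⟩
  | add x y _ _ hx hy =>
    obtain ⟨e, rfl⟩ := hx
    obtain ⟨e', rfl⟩ := hy
    exact ⟨e + e', by simp [add_smul, Finset.sum_add_distrib]⟩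
  | smul r x _ hx =>
    obtain ⟨e, rfl⟩ := hx
    exact ⟨r • e, by simp [Finset.smul_sum, mul_smul]⟩
  | mem x hx =>
    obtain ⟨N, ⟨hN, hN'⟩, rfl⟩ := hx
    refine ⟨fun M => if M = N then 1 else 0, ?_⟩
    simp [ite_smul, hN]

lemma ASLead.ne_zero [IsAlgClosed L] {f : ASPt L a b c → L} {N : ℕ} (h : ASLead L a b c f N) :
    f ≠ 0 := by
  rintro rfl
  obtain ⟨-, κ, hκ, hk⟩ := h
  obtain ⟨e, he⟩ := asV_exists hk
  have : Infinite L := IsAlgClosed.instInfinite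
  obtain ⟨X, hX, hXc⟩ := (Set.infinite_univ (α := L) |>.sdiff (Set.finite_singleton (0 : L))).exists_subset_card_eq (N + 1)
  let e' : ℕ → F := fun M => if M < N then e M else if M = N then κ else 0
  have hq : 0 < Fintype.card F := Fintype.card_pos
  have key := as_indep (a := a) (b := b) (c := c) e' (N + 1) X
    (fun x hx => by simpa using hX hx) hXc.ge ?_ N (by nlinarith)
  · simp [e'] at key; exact hκ key
  · intro p _
    have h1 : ∑ M ∈ range (N + 1), algebraMap F L (e' M) * asFun L a b c M p = 0 := by
      rw [Finset.sum_range_succ]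
      have h2 := congrFun he p
      simp only [Pi.sub_apply, Pi.zero_apply, Pi.smul_apply, Finset.sum_apply] at h2
      simp only [Algebra.smul_def] at h2
      rw [Finset.sum_congr rfl (g := fun M => algebraMap F L (e M) * asFun L a b c M p)
        (fun M hM => by simp [e', mem_range.1 hM]), ← h2]
      simp [e']
    rw [← h1]
    symm
    apply Finset.sum_subset
    · intro M hM; rw [mem_range] at *; nlinarith
    · intro M _ hM
      rw [mem_range] at hM
      have h1 : ¬ M < N := by omega
      have h2 : M ≠ N := by omega
      simp [e', h1, h2]

lemma asLead_sum {ι : Type} [Fintype ι] (g : ι → F) (v : ι → ASPt L a b c → L) (dg : ι → ℕ)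
    (hinj : Function.Injective dg) (hv : ∀ i, ASLead L a b c (v i) (dg i)) (hg : ∃ i, g i ≠ 0) :
    ∃ i, ASLead L a b c (∑ i, g i • v i) (dg i) := by
  classical
  obtain ⟨i0, hi0⟩ := hg
  obtain ⟨i, hi, hmax⟩ := Finset.exists_max_image (univ.filter fun i => g i ≠ 0) dg ⟨i0, by simp [hi0]⟩
  rw [mem_filter] at hi
  refine ⟨i, ?_⟩
  obtain ⟨h0, κ, hκ, hk⟩ := hv i
  refine ⟨h0, g i * κ, mul_ne_zero hi.2 hκ, ?_⟩
  rw [← Finset.add_sum_erase _ _ (mem_univ i), mul_smul, add_sub_right_comm, ← smul_sub]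
  refine Submodule.add_mem _ (Submodule.smul_mem _ _ hk) (Submodule.sum_mem _ fun j hj => ?_)
  by_cases hgj : g j = 0
  · simp [hgj]
  · refine Submodule.smul_mem _ _ (asV_mono ?_ (hv j).mem)
    have h1 := hmax j (by simp [hgj])
    have h2 : dg j ≠ dg i := fun h => (mem_erase.1 hj).1 (hinj h)
    omega

lemma pow_card_pow_smul_sum {ι R : Type} [CommRing R] [Algebra F R] (s : Finset ι) (g : ι → F)
    (v : ι → R) (m : ℕ) :
    (∑ i ∈ s, g i • v i) ^ Fintype.card F ^ m = ∑ i ∈ s, g i • (v i) ^ Fintype.card F ^ m := by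
  induction m with
  | zero => simp
  | succ m ih =>
    rw [pow_succ, pow_mul, ih]
    have := map_sum (FiniteField.frobeniusAlgHom F R) (fun i => g i • (v i) ^ Fintype.card F ^ m) s
    simp only [map_smul, FiniteField.coe_frobeniusAlgHom] at this
    rw [this]
    simp only [pow_mul]

lemma as_frob {y : L} (z : L) (h : y ^ Fintype.card F = y + z) (n : ℕ) :
    y ^ Fintype.card F ^ n = y + ∑ i ∈ range n, z ^ Fintype.card F ^ i := by
  induction n with
  | zero => simp
  | succ n ih =>
    have := map_add ((FiniteField.frobeniusAlgHom F L) ^ n) y z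
    simp only [AlgHom.coe_pow, FiniteField.coe_frobeniusAlgHom, pow_iterate] at this
    rw [pow_succ', pow_mul, h, this, ih, Finset.sum_range_succ, add_assoc]

theorem stepanov [IsAlgClosed L] (ha : a ≠ 0) (m : ℕ)
    (hm : Fintype.card F ^ 2 + 3 * Fintype.card F + 1 < Fintype.card F ^ m) (X : Finset L)
    (hX : ∀ x ∈ X, x ≠ 0 ∧ x ^ Fintype.card F ^ (2 * m) = x ∧
      ∑ i ∈ range (2 * m), (algebraMap F L a * x + algebraMap F L b * x⁻¹ + algebraMap F L c) ^
        Fintype.card F ^ i = 0) :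
    Fintype.card F * X.card ≤
      Fintype.card F ^ (2 * m) + (2 * Fintype.card F + 1) * Fintype.card F ^ m := by
  classical
  set q := Fintype.card F with hq
  have hq1 : 1 < q := Fintype.one_lt_card
  set r := q ^ m with hr
  have hm0 : m ≠ 0 := by rintro rfl; simp at hr; nlinarith
  set w := r + 2 * q with hw
  let I : Finset (ℕ × ℕ) := Ico q r ×ˢ Ico q (w + 1)
  let v : I → (ASPt L a b c → L) := fun i => asFun L a b c i.1.1 ^ r * asFun L a b c i.1.2
  let u : I → (ASPt L a b c → L) := fun i => asFun L a b c i.1.1 * asFun L a b c i.1.2 ^ r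
  let D := r * (r - 1) + w + 1
  have hI : ∀ i : I, q ≤ i.1.1 ∧ i.1.1 < r ∧ q ≤ i.1.2 ∧ i.1.2 ≤ w := by
    rintro ⟨⟨M, N⟩, h⟩
    simp only [I, mem_product, mem_Ico] at h
    dsimp only
    omega
  have hvl : ∀ i : I, ASLead L a b c (v i) (r * i.1.1 + i.1.2) := fun i =>
    ((asLead_fun (Or.inr (hI i).1)).pow ha r).mul ha (asLead_fun (Or.inr (hI i).2.2.1))
  have hul : ∀ i : I, ASLead L a b c (u i) (i.1.1 + r * i.1.2) := fun i =>
    (asLead_fun (Or.inr (hI i).1)).mul ha ((asLead_fun (Or.inr (hI i).2.2.1)).pow ha r)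
  -- a nontrivial relation
  have hdep : ¬ LinearIndependent F v := by
    intro hli
    let W : Submodule F (ASPt L a b c → L) :=
      Submodule.span F ((Finset.image (asFun L a b c) (range D) : Finset _) : Set (ASPt L a b c → L))
    have hvW : ∀ i, v i ∈ W := fun i => by
      have h1 : v i ∈ asV L a b c D := by
        refine asV_mono ?_ (hvl i).mem
        have := hI i
        have h2 : r * i.1.1 ≤ r * (r - 1) := Nat.mul_le_mul_left _ (by omega)
        simp only [D]; omega
      refine Submodule.span_mono ?_ h1
      rintro _ ⟨N, hN, rfl⟩
      simp only [coe_image]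
      exact ⟨N, by simpa using hN.1, rfl⟩
    have hspan : Submodule.span F (Set.range v) ≤ W := by
      rw [Submodule.span_le]; rintro _ ⟨i, rfl⟩; exact hvW i
    have h1 : Fintype.card I ≤ Module.finrank F W := by
      rw [← finrank_span_eq_card hli]
      exact Submodule.finrank_mono hspan
    have h2 : Module.finrank F W ≤ D :=
      (finrank_span_finset_le_card _).trans (card_image_le.trans (by simp))
    have h3 : Fintype.card I = (r - q) * (w + 1 - q) := by simp [I]
    have h4 : (r - q) * (w + 1 - q) ≤ r * (r - 1) + w + 1 := by rw [← h3]; exact h1.trans h2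
    have hrq : q ≤ r := by nlinarith
    obtain ⟨k, hk⟩ := Nat.exists_eq_add_of_le hrq
    have h5 : r - q = k := by omega
    have h6 : w + 1 - q = k + 2 * q + 1 := by omega
    have h7 : r - 1 = k + q - 1 := by omega
    rw [h5, h6] at h4
    have h8 : r * (r - 1) + r = r * r := by
      rw [← Nat.mul_succ]; congr 1; omega
    rw [hk] at hm h8 h4
    nlinarith
  rw [Fintype.not_linearIndependent_iff] at hdep
  obtain ⟨g, hg0, hgne⟩ := hdep
  obtain ⟨i1, hlead⟩ := asLead_sum g u (fun i => i.1.1 + r * i.1.2) (by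
    rintro ⟨⟨M, N⟩, h⟩ ⟨⟨M', N'⟩, h'⟩ he
    have e1 := (hI ⟨(M, N), h⟩).2.1
    have e2 := (hI ⟨(M', N'), h'⟩).2.1
    simp only at he e1 e2
    have hMM : M = M' := by
      have := congrArg (· % r) he
      simpa [Nat.add_mul_mod_self_left, Nat.mod_eq_of_lt, e1, e2] using this
    have hr0 : 0 < r := by omega
    have hNN : N = N' := by
      subst hMM
      exact Nat.eq_of_mul_eq_mul_left hr0 (by omega)
    simp [hMM, hNN]) hul hgne
  set H := ∑ i, g i • u i with hH
  have hHne := hlead.ne_zero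
  let l := q ^ (m - 1) * (w + 1)
  have hql : q * l = r * (w + 1) := by
    simp only [l]; rw [← mul_assoc, mul_pow_sub_one hm0]
  have hHmem : H ∈ asV L a b c (q * l) := by
    refine asV_mono ?_ hlead.mem
    rw [hql]
    have := hI i1
    nlinarith
  obtain ⟨e, he⟩ := asV_exists hHmem
  have hlt : X.card < l := by
    by_contra hcon
    push Not at hcon
    refine hHne ?_
    rw [he]
    have := as_indep (a := a) (b := b) (c := c) e l X (fun x hx => (hX x hx).1) hcon ?_
    · exact Finset.sum_eq_zero fun N hN => by rw [this N (mem_range.1 hN), zero_smul]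
    intro p hp
    have hp2 : H p = 0 := by
      have hr0 : r ≠ 0 := by omega
      obtain ⟨hx0, hxQ, hxT⟩ := hX _ hp
      have hyQ : p.1.2 ^ q ^ (2 * m) = p.1.2 := by
        have hh := p.2.2
        rw [add_assoc, add_assoc, ← add_assoc (algebraMap F L a * _)] at hh
        rw [as_frob _ hh (2 * m), hxT, add_zero]
      have hsQ : ∀ N, asFun L a b c N p ^ (r * r) = asFun L a b c N p := fun N => by
        have hrr : r * r = q ^ (2 * m) := by rw [hr, ← pow_add, two_mul]
        rw [hrr]
        simp only [asFun]
        rw [mul_pow, pow_right_comm p.1.1, pow_right_comm p.1.2, hxQ, hyQ]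
      have h1 : H p ^ r = 0 := by
        have h2 : H ^ r = ∑ i, g i • u i ^ r := pow_card_pow_smul_sum _ _ _ _
        have h3 : H p ^ r = (H ^ r) p := rfl
        rw [h3, h2]
        have h4 := congrFun hg0 p
        rw [Finset.sum_apply] at h4 ⊢
        rw [Pi.zero_apply] at h4
        rw [← h4]
        refine Finset.sum_congr rfl fun i _ => ?_
        simp only [Pi.smul_apply, u, v, Pi.mul_apply, Pi.pow_apply]
        rw [mul_pow, ← pow_mul, hsQ]
      exact pow_eq_zero_iff hr0 |>.1 h1
    rw [he] at hp2
    rw [← hp2, Finset.sum_apply]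
    exact Finset.sum_congr rfl fun N _ => by rw [Pi.smul_apply, Algebra.smul_def]
  have hrr : q ^ (2 * m) = r * r := by rw [hr, ← pow_add, two_mul]
  rw [hrr]
  have : q * X.card ≤ q * l := Nat.mul_le_mul_left _ hlt.le
  rw [hql] at this
  nlinarith

end Stepanov


section ExtBound
open Finset Polynomial

variable {F : Type} [Field F] [Fintype F] {K : Type} [Field K] [Fintype K] [Algebra F K]

open Classical in
lemma trace_fiber_card {a b : F} (ha : a ≠ 0) (m : ℕ) (hK : Module.finrank F K = 2 * m)
    (hm : Fintype.card F ^ 2 + 3 * Fintype.card F + 1 < Fintype.card F ^ m)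
    (hchar : ((2 * m : ℕ) : F) ≠ 0) (c : F) :
    Fintype.card F * #{x : K | x ≠ 0 ∧ Algebra.trace F K (a • x + b • x⁻¹) = c} ≤
      Fintype.card F ^ (2 * m) + (2 * Fintype.card F + 1) * Fintype.card F ^ m := by
  let L := AlgebraicClosure K
  let i : K →ₐ[F] L := IsScalarTower.toAlgHom F K L
  have hinj : Function.Injective i := i.toRingHom.injective
  set T : Finset K := {x : K | x ≠ 0 ∧ Algebra.trace F K (a • x + b • x⁻¹) = c} with hT
  let c' : F := - c / ((2 * m : ℕ) : F)
  have := stepanov (L := L) (b := b) (c := c') ha m hm (T.image i) ?_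
  · rwa [Finset.card_image_of_injective _ hinj] at this
  intro x hx
  obtain ⟨x, hxT, rfl⟩ := Finset.mem_image.1 hx
  obtain ⟨hx0, htr⟩ := (Finset.mem_filter.1 hxT).2
  refine ⟨(map_ne_zero_iff _ hinj).2 hx0, ?_, ?_⟩
  · rw [← map_pow, ← hK, ← Module.card_eq_pow_finrank (K := F) (V := K), FiniteField.pow_card]
  · have h1 : Algebra.trace F K (a • x + b • x⁻¹ + algebraMap F K c') = 0 := by
      rw [map_add, htr, Algebra.trace_algebraMap, hK, nsmul_eq_mul]
      simp only [c']
      field_simp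
      ring
    have h2 := FiniteField.algebraMap_trace_eq_sum_pow F K (a • x + b • x⁻¹ + algebraMap F K c')
    rw [h1, map_zero, hK] at h2
    have h3 := congrArg i h2
    rw [map_zero, map_sum] at h3
    rw [h3]
    refine Finset.sum_congr rfl fun j _ => ?_
    rw [map_pow, Nat.card_eq_fintype_card]
    congr 1
    simp [Algebra.smul_def]

open Classical in
theorem kloo_ext_bound {a b : F} (ha : a ≠ 0) (m : ℕ) (hK : Module.finrank F K = 2 * m)
    (hm : Fintype.card F ^ 2 + 3 * Fintype.card F + 1 < Fintype.card F ^ m)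
    (hchar : ((2 * m : ℕ) : F) ≠ 0) (ψ : AddChar F ℂ) (hψ : ψ ≠ 1) :
    ‖∑ x : K, if x = 0 then 0 else ψ (Algebra.trace F K (a • x + b • x⁻¹))‖ ≤
      7 * Fintype.card F * (Fintype.card F : ℝ) ^ m := by
  set q := Fintype.card F with hq
  have hq0 : (1 : ℝ) ≤ q := by exact_mod_cast Fintype.card_pos
  have hqm : (1 : ℝ) ≤ (q : ℝ) ^ m := one_le_pow₀ hq0
  let N : F → ℕ := fun c => #{x : K | x ≠ 0 ∧ Algebra.trace F K (a • x + b • x⁻¹) = c}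
  let u : F → ℝ := fun c => N c - (q : ℝ) ^ (2 * m) / q
  have hub : ∀ c, u c ≤ 3 * (q : ℝ) ^ m := fun c => by
    have h := trace_fiber_card (K := K) (b := b) ha m hK hm hchar c
    have h' : (q : ℝ) * N c ≤ (q : ℝ) ^ (2 * m) + (2 * q + 1) * (q : ℝ) ^ m := by exact_mod_cast h
    simp only [u]
    rw [sub_le_iff_le_add, ← mul_le_mul_iff_right₀ (show (0 : ℝ) < q by linarith), mul_add,
      mul_div_cancel₀ _ (by linarith : (q : ℝ) ≠ 0)]
    nlinarith
  have hsumN : ∑ c, (N c : ℝ) = (q : ℝ) ^ (2 * m) - 1 := by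
    have h1 : ∑ c, N c = #{x : K | x ≠ 0} := by
      rw [Finset.card_eq_sum_card_fiberwise (t := univ)
        (f := fun x : K => Algebra.trace F K (a • x + b • x⁻¹)) (by simp)]
      refine Finset.sum_congr rfl fun c _ => ?_
      simp only [N, Finset.filter_filter]
    have h2 : #{x : K | x ≠ 0} + 1 = q ^ (2 * m) := by
      rw [← hK, hq, ← Module.card_eq_pow_finrank (K := F) (V := K), Finset.filter_ne',
        Finset.card_erase_add_one (mem_univ _), Finset.card_univ]
    have h3 : ∑ c, (N c : ℝ) + 1 = (q : ℝ) ^ (2 * m) := by rw [← h1] at h2; exact_mod_cast h2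
    linarith
  have hsumu : ∑ c, u c = -1 := by
    simp only [u, Finset.sum_sub_distrib, hsumN, Finset.sum_const, Finset.card_univ, nsmul_eq_mul,
      ← hq]
    field_simp
    ring
  have habs : ∑ c, |u c| ≤ 7 * q * (q : ℝ) ^ m := by
    have h1 : ∀ c, |u c| ≤ 2 * (3 * (q : ℝ) ^ m) - u c := fun c => by
      rw [abs_le]; constructor <;> nlinarith [hub c]
    calc ∑ c, |u c| ≤ ∑ c, (2 * (3 * (q : ℝ) ^ m) - u c) := Finset.sum_le_sum fun c _ => h1 c
      _ = q * (2 * (3 * (q : ℝ) ^ m)) + 1 := by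
        rw [Finset.sum_sub_distrib, hsumu]; simp [← hq]
      _ ≤ _ := by nlinarith
  have hS : ∑ x : K, (if x = 0 then 0 else ψ (Algebra.trace F K (a • x + b • x⁻¹))) =
      ∑ c, ψ c * (u c : ℂ) := by
    have h1 : ∑ c, ψ c * (u c : ℂ) = ∑ c, ψ c * (N c : ℂ) := by
      simp only [u]
      push_cast
      simp only [mul_sub, Finset.sum_sub_distrib, ← Finset.sum_mul, AddChar.sum_eq_zero_of_ne_one hψ]
      simp
    rw [h1]
    have h2 : ∀ c, ψ c * (N c : ℂ) = ∑ x : K, if x ≠ 0 ∧ Algebra.trace F K (a • x + b • x⁻¹) = c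
        then ψ c else 0 := fun c => by
      rw [← Finset.sum_filter, Finset.sum_const, nsmul_eq_mul, mul_comm]
    simp only [h2]
    rw [Finset.sum_comm]
    refine Finset.sum_congr rfl fun x _ => ?_
    by_cases hx : x = 0 <;> simp [hx]
  rw [hS]
  refine (norm_sum_le _ _).trans (le_trans (Finset.sum_le_sum fun c _ => ?_) habs)
  rw [norm_mul, AddChar.norm_apply, one_mul, Complex.norm_real, Real.norm_eq_abs]

end ExtBound


section LFun
open Finset Polynomial

variable {F : Type} [Field F] [Fintype F]

/-- monic polynomials of degree `n` -/
noncomputable def monicSet (F : Type) [Field F] [Fintype F] (n : ℕ) : Finset F[X] := by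
  classical
  exact (Finset.univ : Finset (Fin n → F)).image
    (fun c => X ^ n + ∑ i : Fin n, C (c i) * X ^ (i : ℕ))

lemma mem_monicSet {n : ℕ} {f : F[X]} : f ∈ monicSet F n ↔ f.Monic ∧ f.natDegree = n := by
  simp only [monicSet, Finset.mem_image, Finset.mem_univ, true_and]
  constructor
  · rintro ⟨c, rfl⟩
    have hd : (∑ i : Fin n, C (c i) * X ^ (i : ℕ)).degree < (n : WithBot ℕ) := by
      refine (degree_sum_le _ _).trans_lt ?_
      rw [Finset.sup_lt_iff (WithBot.bot_lt_coe _)]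
      intro i hi
      exact (degree_C_mul_X_pow_le _ _).trans_lt (by exact_mod_cast i.2)
    exact ⟨monic_X_pow_add hd, by
      rw [natDegree_eq_of_degree_eq_some]; rw [degree_add_eq_left_of_degree_lt] <;> simp [hd]⟩
  · rintro ⟨hf, rfl⟩
    refine ⟨fun i => f.coeff i, ?_⟩
    rw [Fin.sum_univ_eq_sum_range (fun i => C (f.coeff i) * X ^ i)]
    exact hf.as_sum.symm

/-- monic irreducible polynomials of degree between `1` and `n` -/
noncomputable def irrSet (F : Type) [Field F] [Fintype F] (n : ℕ) : Finset F[X] := by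
  classical
  exact ((Finset.Icc 1 n).biUnion (monicSet F)).filter Irreducible

lemma mem_irrSet {n : ℕ} {f : F[X]} :
    f ∈ irrSet F n ↔ f.Monic ∧ Irreducible f ∧ f.natDegree ≤ n := by
  classical
  simp only [irrSet, Finset.mem_filter, Finset.mem_biUnion, mem_monicSet, Finset.mem_Icc]
  constructor
  · rintro ⟨⟨d, hd, hm, rfl⟩, hi⟩
    exact ⟨hm, hi, hd.2⟩
  · rintro ⟨hm, hi, hn⟩
    exact ⟨⟨_, ⟨hi.natDegree_pos, hn⟩, hm, rfl⟩, hi⟩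

open Classical in
lemma degree_count {n : ℕ} {f : F[X]} (hf : f ∈ monicSet F n) :
    n = ∑ P ∈ irrSet F n, ∑ k ∈ Icc 1 n, if P ^ k ∣ f then P.natDegree else 0 := by
  obtain ⟨hm, hd⟩ := mem_monicSet.1 hf
  have hf0 := hm.ne_zero
  let s := UniqueFactorizationMonoid.normalizedFactors f
  have hprod : s.prod = f := by
    rw [UniqueFactorizationMonoid.prod_normalizedFactors_eq hf0, hm.normalize_eq_self]
  have hirr : ∀ P ∈ s, P.Monic ∧ Irreducible P := fun P hP => by
    have h1 := UniqueFactorizationMonoid.irreducible_of_normalized_factor P hP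
    refine ⟨?_, h1⟩
    rw [← UniqueFactorizationMonoid.normalize_normalized_factor P hP]
    exact monic_normalize h1.ne_zero
  have hdvd : ∀ P : F[X], P.Monic → Irreducible P → ∀ k, P ^ k ∣ f ↔ k ≤ s.count P := by
    intro P hPm hPi k
    rw [pow_dvd_iff_le_emultiplicity,
      UniqueFactorizationMonoid.emultiplicity_eq_count_normalizedFactors hPi hf0,
      hPm.normalize_eq_self]
    simp [s]
  have hcount : ∀ P : F[X], P.Monic → Irreducible P → s.count P * P.natDegree ≤ n := by
    intro P hPm hPi
    have h1 := natDegree_le_of_dvd ((hdvd P hPm hPi _).2 le_rfl) hf0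
    rwa [natDegree_pow, hd] at h1
  have hdeg : n = ∑ P ∈ s.toFinset, s.count P * P.natDegree := by
    have h1 : s.prod.natDegree = (s.map natDegree).sum :=
      natDegree_multiset_prod_of_monic _ fun P hP => (hirr P hP).1
    rw [hprod, hd, Finset.sum_multiset_map_count] at h1
    simpa using h1
  conv_lhs => rw [hdeg]
  have hsub : s.toFinset ⊆ irrSet F n := fun P hP => by
    have hP' := Multiset.mem_toFinset.1 hP
    obtain ⟨h1, h2⟩ := hirr P hP'
    refine mem_irrSet.2 ⟨h1, h2, ?_⟩
    have := hcount P h1 h2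
    have h3 : 1 ≤ s.count P := Multiset.one_le_count_iff_mem.2 hP'
    nlinarith
  rw [Finset.sum_subset hsub]
  · refine Finset.sum_congr rfl fun P hP => ?_
    obtain ⟨h1, h2, -⟩ := mem_irrSet.1 hP
    rw [← Finset.sum_filter, Finset.sum_const, smul_eq_mul]
    congr 1
    have h3 : (Icc 1 n).filter (fun k => P ^ k ∣ f) = Icc 1 (s.count P) := by
      ext k
      simp only [Finset.mem_filter, Finset.mem_Icc, hdvd P h1 h2]
      have := hcount P h1 h2
      have h4 := h2.natDegree_pos
      constructor
      · omega
      · intro h; refine ⟨⟨h.1, ?_⟩, h.2⟩; nlinarith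
    rw [h3]; simp
  · intro P _ hP
    rw [Multiset.mem_toFinset] at hP
    simp [Multiset.count_eq_zero_of_notMem hP]

/-- sum of `Λ` over monic polynomials -/
noncomputable def lCoeff (Λ : F[X] → ℂ) (n : ℕ) : ℂ := ∑ f ∈ monicSet F n, Λ f

open Classical in
/-- sum of `Λ` over prime powers, weighted -/
noncomputable def sCoeff (Λ : F[X] → ℂ) (n : ℕ) : ℂ :=
  ∑ P ∈ (irrSet F n).filter (fun P => P.natDegree ∣ n), (P.natDegree : ℂ) * Λ P ^ (n / P.natDegree)

lemma Lam_pow {Λ : F[X] → ℂ} (h1 : Λ 1 = 1)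
    (hmul : ∀ f g : F[X], f.Monic → g.Monic → Λ (f * g) = Λ f * Λ g) {P : F[X]} (hP : P.Monic)
    (k : ℕ) : Λ (P ^ k) = Λ P ^ k := by
  induction k with
  | zero => simp [h1]
  | succ k ih => rw [pow_succ, hmul _ _ (hP.pow k) hP, ih, pow_succ]

open Classical in
lemma sum_dvd {Λ : F[X] → ℂ} (h1 : Λ 1 = 1)
    (hmul : ∀ f g : F[X], f.Monic → g.Monic → Λ (f * g) = Λ f * Λ g) {P : F[X]} (hP : P.Monic)
    (n k : ℕ) :
    ∑ f ∈ (monicSet F n).filter (fun f => P ^ k ∣ f), Λ f =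
      if k * P.natDegree ≤ n then Λ P ^ k * lCoeff Λ (n - k * P.natDegree) else 0 := by
  have hPk := hP.pow k
  split_ifs with h
  · rw [lCoeff, Finset.mul_sum]
    symm
    refine Finset.sum_bij (fun g _ => P ^ k * g) ?_ ?_ ?_ ?_
    · intro g hg
      obtain ⟨hg1, hg2⟩ := mem_monicSet.1 hg
      refine Finset.mem_filter.2 ⟨mem_monicSet.2 ⟨hPk.mul hg1, ?_⟩, dvd_mul_right _ _⟩
      rw [hPk.natDegree_mul hg1, hP.natDegree_pow, hg2]; omega
    · intro g _ g' _ he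
      exact mul_left_cancel₀ hPk.ne_zero he
    · intro f hf
      obtain ⟨hf1, g, rfl⟩ := Finset.mem_filter.1 hf
      obtain ⟨hf2, hf3⟩ := mem_monicSet.1 hf1
      have hgm := hPk.of_mul_monic_left hf2
      refine ⟨g, mem_monicSet.2 ⟨hgm, ?_⟩, rfl⟩
      rw [hPk.natDegree_mul hgm, hP.natDegree_pow] at hf3
      omega
    · intro g hg
      rw [hmul _ _ hPk (mem_monicSet.1 hg).1, Lam_pow h1 hmul hP]
  · refine Finset.sum_eq_zero fun f hf => ?_
    exfalso
    obtain ⟨hf1, hf2⟩ := Finset.mem_filter.1 hf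
    obtain ⟨hf3, hf4⟩ := mem_monicSet.1 hf1
    have := natDegree_le_of_dvd hf2 hf3.ne_zero
    rw [hP.natDegree_pow, hf4] at this
    exact h this

theorem newton_identity {Λ : F[X] → ℂ} (h1 : Λ 1 = 1)
    (hmul : ∀ f g : F[X], f.Monic → g.Monic → Λ (f * g) = Λ f * Λ g) (n : ℕ) :
    (n : ℂ) * lCoeff Λ n = ∑ j ∈ Icc 1 n, sCoeff Λ j * lCoeff Λ (n - j) := by
  classical
  have hL : (n : ℂ) * lCoeff Λ n = ∑ P ∈ irrSet F n, ∑ k ∈ Icc 1 n,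
      (P.natDegree : ℂ) * ∑ f ∈ (monicSet F n).filter (fun f => P ^ k ∣ f), Λ f := by
    rw [lCoeff, Finset.mul_sum]
    have : ∀ f ∈ monicSet F n, (n : ℂ) * Λ f = ∑ P ∈ irrSet F n, ∑ k ∈ Icc 1 n,
        if P ^ k ∣ f then (P.natDegree : ℂ) * Λ f else 0 := fun f hf => by
      conv_lhs => rw [degree_count hf]
      push_cast
      rw [Finset.sum_mul]
      refine Finset.sum_congr rfl fun P _ => ?_
      rw [Finset.sum_mul]
      refine Finset.sum_congr rfl fun k _ => ?_
      split_ifs <;> simp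
    rw [Finset.sum_congr rfl this, Finset.sum_comm]
    refine Finset.sum_congr rfl fun P _ => ?_
    rw [Finset.sum_comm]
    refine Finset.sum_congr rfl fun k _ => ?_
    rw [← Finset.sum_filter, Finset.mul_sum]
  have hR : ∑ j ∈ Icc 1 n, sCoeff Λ j * lCoeff Λ (n - j) = ∑ P ∈ irrSet F n, ∑ j ∈ Icc 1 n,
      if P.natDegree ∣ j then (P.natDegree : ℂ) * Λ P ^ (j / P.natDegree) * lCoeff Λ (n - j)
      else 0 := by
    rw [Finset.sum_comm]
    refine Finset.sum_congr rfl fun j hj => ?_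
    rw [← Finset.sum_filter, sCoeff, Finset.sum_mul]
    refine Finset.sum_congr ?_ fun _ _ => rfl
    ext P
    rw [Finset.mem_Icc] at hj
    simp only [Finset.mem_filter, mem_irrSet]
    constructor
    · rintro ⟨⟨ha, hb, hc⟩, hd⟩; exact ⟨⟨ha, hb, by omega⟩, hd⟩
    · rintro ⟨⟨ha, hb, hc⟩, hd⟩; exact ⟨⟨ha, hb, Nat.le_of_dvd (by omega) hd⟩, hd⟩
  rw [hL, hR]
  refine Finset.sum_congr rfl fun P hP => ?_
  obtain ⟨hPm, hPi, -⟩ := mem_irrSet.1 hP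
  have hd := hPi.natDegree_pos
  simp only [sum_dvd h1 hmul hPm, mul_ite, mul_zero]
  rw [← Finset.sum_filter, ← Finset.sum_filter]
  refine Finset.sum_bij' (fun k _ => k * P.natDegree) (fun j _ => j / P.natDegree) ?_ ?_ ?_ ?_ ?_
  · intro k hk
    simp only [Finset.mem_filter, Finset.mem_Icc] at hk ⊢
    exact ⟨⟨by nlinarith, hk.2⟩, dvd_mul_left _ _⟩
  · intro j hj
    simp only [Finset.mem_filter, Finset.mem_Icc] at hj ⊢
    obtain ⟨hj, k, rfl⟩ := hj
    rw [Nat.mul_div_cancel_left _ hd]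
    refine ⟨⟨?_, by nlinarith⟩, by nlinarith⟩
    rcases k with _ | k
    · simp at hj
    · omega
  · intro k _; exact Nat.mul_div_cancel _ hd
  · intro j hj
    exact Nat.div_mul_cancel (Finset.mem_filter.1 hj).2
  · intro k _
    rw [Nat.mul_div_cancel _ hd, mul_assoc]

end LFun


section Kloo
open Finset Polynomial

variable {F : Type} [Field F] [Fintype F] {K : Type} [Field K] [Fintype K] [Algebra F K]

lemma minpoly_inv_dvd {x : K} (hx : x ≠ 0) :
    minpoly F x⁻¹ ∣ (minpoly F x).reverse := by
  apply minpoly.dvd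
  letI := invertibleOfNonzero hx
  have := (eval₂_reverse_eq_zero_iff (algebraMap F K) x (minpoly F x)).2 (minpoly.aeval F x)
  rwa [invOf_eq_inv] at this

lemma minpoly_inv_natDegree_le {x : K} (hx : x ≠ 0) :
    (minpoly F x⁻¹).natDegree ≤ (minpoly F x).natDegree := by
  have hIntg : IsIntegral F x := Algebra.IsIntegral.isIntegral x
  have h0 : (minpoly F x).reverse ≠ 0 := by
    rw [Ne, reverse_eq_zero]; exact minpoly.ne_zero hIntg
  exact (natDegree_le_of_dvd (minpoly_inv_dvd hx) h0).trans (reverse_natDegree_le _)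

lemma minpoly_inv_natDegree {x : K} (hx : x ≠ 0) :
    (minpoly F x⁻¹).natDegree = (minpoly F x).natDegree := by
  refine le_antisymm (minpoly_inv_natDegree_le hx) ?_
  have := minpoly_inv_natDegree_le (F := F) (inv_ne_zero hx)
  rwa [inv_inv] at this

lemma minpoly_inv_nextCoeff {x : K} (hx : x ≠ 0) :
    (minpoly F x⁻¹).nextCoeff = (minpoly F x).coeff 1 / (minpoly F x).coeff 0 := by
  have hIntg : IsIntegral F x := Algebra.IsIntegral.isIntegral x
  have hIntg' : IsIntegral F x⁻¹ := Algebra.IsIntegral.isIntegral _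
  set P := minpoly F x with hP
  have hc0 : P.coeff 0 ≠ 0 := by rw [Ne, minpoly.coeff_zero_eq_zero hIntg]; exact hx
  have hd : 0 < P.natDegree := minpoly.natDegree_pos hIntg
  have h0 : P.natTrailingDegree = 0 := natTrailingDegree_eq_zero.2 (Or.inr hc0)
  have hrd : P.reverse.natDegree = P.natDegree := by rw [reverse_natDegree, h0, Nat.sub_zero]
  have h1 := eq_leadingCoeff_mul_of_monic_of_dvd_of_natDegree_le (minpoly.monic hIntg')
    (minpoly_inv_dvd (F := F) hx) (by rw [← hP, hrd, minpoly_inv_natDegree hx])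
  rw [← hP, reverse_leadingCoeff, trailingCoeff, h0] at h1
  have h2 := congrArg (fun Q => Q.coeff (P.natDegree - 1)) h1
  simp only [coeff_C_mul, coeff_reverse] at h2
  rw [revAt_le (by omega), show P.natDegree - (P.natDegree - 1) = 1 by omega] at h2
  rw [nextCoeff_of_natDegree_pos (by rw [minpoly_inv_natDegree hx]; exact hd),
    minpoly_inv_natDegree hx, h2, ← hP, mul_div_cancel_left₀ _ hc0]

open Classical in
/-- Kloosterman character on monic polynomials -/
noncomputable def kLam (ψ : AddChar F ℂ) (a b : F) (f : F[X]) : ℂ :=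
  if f.coeff 0 = 0 then 0 else ψ (-(a * f.nextCoeff + b * (f.coeff 1 / f.coeff 0)))

lemma kLam_one (ψ : AddChar F ℂ) (a b : F) : kLam ψ a b 1 = 1 := by
  simp [kLam, nextCoeff, coeff_one]

lemma kLam_mul (ψ : AddChar F ℂ) (a b : F) (f g : F[X]) (hf : f.Monic) (hg : g.Monic) :
    kLam ψ a b (f * g) = kLam ψ a b f * kLam ψ a b g := by
  unfold kLam
  rw [mul_coeff_zero, mul_coeff_one, hf.nextCoeff_mul hg]
  by_cases h1 : f.coeff 0 = 0
  · simp [h1]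
  by_cases h2 : g.coeff 0 = 0
  · simp [h2]
  rw [if_neg (mul_ne_zero h1 h2), if_neg h1, if_neg h2, ← AddChar.map_add_eq_mul]
  congr 1
  field_simp
  ring

lemma kLam_minpoly (ψ : AddChar F ℂ) (a b : F) {x : K} (hx : x ≠ 0) :
    ψ (Algebra.trace F K (a • x + b • x⁻¹)) =
      kLam ψ a b (minpoly F x) ^ (Module.finrank F K / (minpoly F x).natDegree) := by
  have hIntg : ∀ x : K, IsIntegral F x := fun x => Algebra.IsIntegral.isIntegral x
  have hc0 : (minpoly F x).coeff 0 ≠ 0 := by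
    rw [Ne, minpoly.coeff_zero_eq_zero (hIntg x)]; exact hx
  have hfin : ∀ y : K, Module.finrank (IntermediateField.adjoin F {y}) K =
      Module.finrank F K / (minpoly F y).natDegree := fun y => by
    rw [← IntermediateField.adjoin.finrank (hIntg y),
      ← Module.finrank_mul_finrank F (IntermediateField.adjoin F {y}) K,
      Nat.mul_div_cancel_left _ Module.finrank_pos]
  rw [map_add, map_smul, map_smul, trace_eq_finrank_mul_minpoly_nextCoeff,
    trace_eq_finrank_mul_minpoly_nextCoeff, hfin, hfin, minpoly_inv_natDegree hx,
    minpoly_inv_nextCoeff hx, kLam, if_neg hc0, ← AddChar.map_nsmul_eq_pow]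
  congr 1
  simp only [smul_eq_mul, nsmul_eq_mul]
  ring

open Classical in
lemma minpoly_fiber {P : F[X]} (hP : P.Monic) (hPi : Irreducible P)
    (hd : P.natDegree ∣ Module.finrank F K) :
    #{x : K | minpoly F x = P} = P.natDegree := by
  have hdvd := hPi.natDegree_dvd_iff_dvd_X_pow_card_pow_sub_X.1 hd
  have hcard : Nat.card F ^ Module.finrank F K = Fintype.card K := by
    rw [Nat.card_eq_fintype_card, ← Module.card_eq_pow_finrank (K := F) (V := K)]
  rw [hcard] at hdvd
  have hs := (FiniteField.isSplittingField_sub K F).splits'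
  have hne : (X ^ Fintype.card K - X : F[X]) ≠ 0 :=
    FiniteField.X_pow_card_sub_X_ne_zero F Fintype.one_lt_card
  have hs' : (P.map (algebraMap F K)).Splits :=
    hs.of_dvd (Polynomial.map_ne_zero hne) (Polynomial.map_dvd _ hdvd)
  rw [← card_rootSet_eq_natDegree (PerfectField.separable_of_irreducible hPi) hs',
    ← Set.toFinset_card]
  congr 1
  ext x
  simp only [mem_filter, mem_univ, true_and, Set.mem_toFinset, mem_rootSet]
  constructor
  · rintro rfl; exact ⟨hP.ne_zero, minpoly.aeval F x⟩
  · rintro ⟨-, h⟩; exact (minpoly.eq_of_irreducible_of_monic hPi h hP).symm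

open Classical in
lemma sCoeff_kLam (ψ : AddChar F ℂ) (a b : F) :
    sCoeff (kLam ψ a b) (Module.finrank F K) =
      ∑ x : K, if x = 0 then 0 else ψ (Algebra.trace F K (a • x + b • x⁻¹)) := by
  have hIntg : ∀ x : K, IsIntegral F x := fun x => Algebra.IsIntegral.isIntegral x
  have hn : 0 < Module.finrank F K := Module.finrank_pos
  have h1 : ∀ x : K, (if x = 0 then 0 else ψ (Algebra.trace F K (a • x + b • x⁻¹))) =
      kLam ψ a b (minpoly F x) ^ (Module.finrank F K / (minpoly F x).natDegree) := by
    intro x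
    by_cases hx : x = 0
    · subst hx
      have h1 : (minpoly F (0 : K)).natDegree = 1 := by rw [minpoly.zero, natDegree_X]
      rw [if_pos rfl, h1, minpoly.zero, Nat.div_one]
      simp [kLam, hn.ne']
    · rw [if_neg hx, kLam_minpoly ψ a b hx]
  simp only [h1]
  rw [← Finset.sum_fiberwise_of_maps_to (g := fun x : K => minpoly F x)
    (t := (irrSet F (Module.finrank F K)).filter (fun P => P.natDegree ∣ Module.finrank F K))]
  · rw [sCoeff]
    refine Finset.sum_congr rfl fun P hP => ?_
    obtain ⟨hP1, hP2⟩ := mem_filter.1 hP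
    obtain ⟨hPm, hPi, -⟩ := mem_irrSet.1 hP1
    rw [Finset.sum_congr rfl (g := fun _ => kLam ψ a b P ^ (Module.finrank F K / P.natDegree))
      (fun x hx => by rw [(mem_filter.1 hx).2]), Finset.sum_const, minpoly_fiber hPm hPi hP2,
      nsmul_eq_mul]
  · intro x _
    have hd := minpoly.degree_dvd (hIntg x)
    exact mem_filter.2 ⟨mem_irrSet.2 ⟨minpoly.monic (hIntg x), minpoly.irreducible (hIntg x),
      Nat.le_of_dvd hn hd⟩, hd⟩

lemma lCoeff_zero (ψ : AddChar F ℂ) (a b : F) : lCoeff (kLam ψ a b) 0 = 1 := by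
  have : monicSet F 0 = {1} := by
    ext f
    rw [mem_monicSet, mem_singleton]
    constructor
    · rintro ⟨h1, h2⟩; exact h1.natDegree_eq_zero.1 h2
    · rintro rfl; simp [monic_one]
  rw [lCoeff, this, sum_singleton, kLam_one]

lemma lCoeff_two {ψ : AddChar F ℂ} (hψ : ψ ≠ 1) {a b : F} (ha : a ≠ 0) (hb : b ≠ 0) :
    lCoeff (kLam ψ a b) 2 = Fintype.card F := by
  classical
  have h1 : lCoeff (kLam ψ a b) 2 = ∑ p : F × F, if p.2 = 0 then 0 else
      ψ (p.1 * (-(a + b / p.2))) := by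
    rw [lCoeff]
    symm
    have hpoly : ∀ u v : F, (X ^ 2 + C u * X + C v).Monic ∧
        (X ^ 2 + C u * X + C v).natDegree = 2 := fun u v => by
      have : (X ^ 2 + C u * X + C v) = (C 1 * X ^ 2 + C u * X + C v) := by simp
      rw [this]
      exact ⟨leadingCoeff_quadratic one_ne_zero, natDegree_quadratic one_ne_zero⟩
    refine Finset.sum_bij' (fun p _ => X ^ 2 + C p.1 * X + C p.2) (fun f _ => (f.coeff 1, f.coeff 0))
      ?_ ?_ ?_ ?_ ?_
    · intro p _; exact mem_monicSet.2 (hpoly _ _)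
    · intro f _; exact mem_univ _
    · intro p _; simp [coeff_X, coeff_C, coeff_X_pow]
    · intro f hf
      obtain ⟨hm, hd⟩ := mem_monicSet.1 hf
      have := hm.as_sum
      rw [hd] at this
      rw [this]
      simp [Finset.sum_range_succ, coeff_X, coeff_C, coeff_X_pow]
      ring
    · rintro ⟨u, v⟩ _
      have e0 : (X ^ 2 + C u * X + C v).coeff 0 = v := by simp
      have e1 : (X ^ 2 + C u * X + C v).coeff 1 = u := by simp [coeff_X_pow, coeff_C]
      have e2 : (X ^ 2 + C u * X + C v).nextCoeff = u := by
        rw [nextCoeff_of_natDegree_pos (by rw [(hpoly u v).2]; norm_num), (hpoly u v).2]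
        exact e1
      simp only [kLam, e0, e1, e2]
      split_ifs
      · rfl
      · congr 1; ring
  rw [h1, Fintype.sum_prod_type_right]
  have h2 : ∀ v : F, (∑ u : F, if v = 0 then (0 : ℂ) else ψ (u * (-(a + b / v)))) =
      if v = - b / a then (Fintype.card F : ℂ) else 0 := fun v => by
    by_cases hv : v = 0
    · subst hv
      have : (0 : F) ≠ -b / a := by
        intro h; exact div_ne_zero (neg_ne_zero.2 hb) ha h.symm
      simp [this]
    · simp only [if_neg hv]
      rw [AddChar.sum_mulShift _ (AddChar.IsPrimitive.of_ne_one hψ)]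
      have : -(a + b / v) = 0 ↔ v = -b / a := by
        rw [eq_div_iff ha, neg_eq_zero]
        field_simp
        constructor <;> intro h <;> linear_combination h
      simp only [this]
      split_ifs <;> simp
  simp only [h2]
  simp

lemma lCoeff_ge_three {ψ : AddChar F ℂ} (hψ : ψ ≠ 1) {a b : F} (ha : a ≠ 0) {n : ℕ} (hn : 3 ≤ n) :
    lCoeff (kLam ψ a b) n = 0 := by
  obtain ⟨w, hw⟩ : ∃ w, ψ w ≠ 1 := by
    by_contra h; push Not at h; exact hψ (by ext x; simp [h x])
  set u := - w / a with hu
  have hdeg : ∀ u : F, (C u * X ^ (n - 1)).degree < (n : WithBot ℕ) := fun u =>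
    (degree_C_mul_X_pow_le _ _).trans_lt (by exact_mod_cast (by omega : n - 1 < n))
  have hmem : ∀ u : F, ∀ f ∈ monicSet F n, f + C u * X ^ (n - 1) ∈ monicSet F n := by
    intro u f hf
    obtain ⟨h1, h2⟩ := mem_monicSet.1 hf
    have h3 : (C u * X ^ (n - 1)).degree < f.degree := by
      rw [degree_eq_natDegree h1.ne_zero, h2]; exact hdeg u
    refine mem_monicSet.2 ⟨h1.add_of_left h3, ?_⟩
    exact (natDegree_eq_of_degree_eq (degree_add_eq_left_of_degree_lt h3)).trans h2
  have hval : ∀ f ∈ monicSet F n, kLam ψ a b (f + C u * X ^ (n - 1)) = ψ w * kLam ψ a b f := by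
    intro f hf
    have hm := mem_monicSet.1 (hmem u f hf)
    have hm' := mem_monicSet.1 hf
    have e0 : (f + C u * X ^ (n - 1)).coeff 0 = f.coeff 0 := by
      simp [coeff_X_pow]
      omega
    have e1 : (f + C u * X ^ (n - 1)).coeff 1 = f.coeff 1 := by
      simp [coeff_X_pow]
      omega
    have e2 : (f + C u * X ^ (n - 1)).nextCoeff = f.nextCoeff + u := by
      rw [nextCoeff_of_natDegree_pos (by omega), nextCoeff_of_natDegree_pos (by omega), hm.2, hm'.2]
      simp
    by_cases h0 : f.coeff 0 = 0
    · rw [kLam, kLam, if_pos (by rw [e0]; exact h0), if_pos h0, mul_zero]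
    · rw [kLam, kLam, if_neg (by rw [e0]; exact h0), if_neg h0, e0, e1, e2,
        ← AddChar.map_add_eq_mul]
      congr 1
      rw [hu]
      field_simp
      ring
  have h : lCoeff (kLam ψ a b) n = ψ w * lCoeff (kLam ψ a b) n := by
    conv_rhs => rw [lCoeff, Finset.mul_sum]
    rw [lCoeff, ← Finset.sum_congr rfl hval]
    symm
    refine Finset.sum_bij' (fun f _ => f + C u * X ^ (n - 1)) (fun f _ => f + C (-u) * X ^ (n - 1))
      (hmem u) (hmem (-u)) ?_ ?_ ?_
    · intro f _; simp
    · intro f _; simp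
    · intro f _; rfl
  have h' : (1 - ψ w) * lCoeff (kLam ψ a b) n = 0 := by linear_combination h
  exact (mul_eq_zero.1 h').resolve_left (sub_ne_zero.2 (Ne.symm hw))

end Kloo


section Weil
open Finset Polynomial

lemma weil_power_trick {q : ℝ} (hq : 1 ≤ q) {α β : ℂ} (hαβ : α * β = q) {p : ℕ} (hp : 1 ≤ p)
    (h : ∀ k : ℕ, 1 ≤ k → ‖α ^ (2 * (p * k + 1)) + β ^ (2 * (p * k + 1))‖ ≤
      7 * q * q ^ (p * k + 1)) : ‖α‖ ≤ √q := by
  have hq0 : 0 < q := by linarith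
  by_contra hlt
  push Not at hlt
  have hα2 : q < ‖α‖ ^ 2 := by
    have := Real.sq_sqrt hq0.le
    have h0 := Real.sqrt_nonneg q
    nlinarith
  have hn : ‖α‖ * ‖β‖ = q := by
    rw [← norm_mul, hαβ, Complex.norm_real, Real.norm_eq_abs, abs_of_pos hq0]
  have hβ2 : ‖β‖ ^ 2 ≤ q := by
    have : ‖α‖ ^ 2 * ‖β‖ ^ 2 = q * q := by rw [← mul_pow, hn]; ring
    by_contra hh
    push Not at hh
    nlinarith
  set r := ‖α‖ ^ 2 / q with hr
  have hr1 : 1 < r := by rw [hr, lt_div_iff₀ hq0]; linarith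
  obtain ⟨k, hk⟩ := pow_unbounded_of_one_lt (7 * q + 1) hr1
  have hk' : 7 * q + 1 < r ^ (p * (k + 1) + 1) :=
    hk.trans_le (pow_le_pow_right₀ hr1.le (by nlinarith))
  have h1 := h (k + 1) (by omega)
  set m := p * (k + 1) + 1 with hm
  have h2 : ‖α ^ (2 * m)‖ ≤ 7 * q * q ^ m + q ^ m := by
    have e : α ^ (2 * m) = (α ^ (2 * m) + β ^ (2 * m)) - β ^ (2 * m) := by ring
    rw [e]
    refine (norm_sub_le _ _).trans (add_le_add h1 ?_)
    rw [norm_pow, pow_mul]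
    exact pow_le_pow_left₀ (by positivity) hβ2 m
  rw [norm_pow, pow_mul] at h2
  have h3 : r ^ m ≤ 7 * q + 1 := by
    rw [hr, div_pow, div_le_iff₀ (by positivity)]
    linarith
  linarith

variable {F : Type} [Field F] [Fintype F]

lemma newton_power (s l : ℕ → ℂ) (q α β : ℂ)
    (hn : ∀ n : ℕ, (n : ℂ) * l n = ∑ j ∈ Icc 1 n, s j * l (n - j))
    (h0 : l 0 = 1) (h2 : l 2 = q) (h3 : ∀ n, 3 ≤ n → l n = 0)
    (hs : α + β = - l 1) (hp : α * β = q) : ∀ n, s (n + 1) = - (α ^ (n + 1) + β ^ (n + 1)) := by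
  have hs1 : s 1 = l 1 := by
    have := hn 1
    simp [h0] at this
    exact this.symm
  have hs2 : s 2 = 2 * q - l 1 * l 1 := by
    have := hn 2
    rw [Finset.sum_Icc_succ_top (by norm_num)] at this
    simp [h0, h2, hs1] at this
    linear_combination -this
  have hrec : ∀ n, s (n + 3) = - (s (n + 2) * l 1 + q * s (n + 1)) := by
    intro n
    have := hn (n + 3)
    rw [h3 _ (by omega), mul_zero, Finset.sum_Icc_succ_top (by omega),
      Finset.sum_Icc_succ_top (by omega), Finset.sum_Icc_succ_top (by omega)] at this
    have hz : ∑ k ∈ Icc 1 n, s k * l (n + 3 - k) = 0 := by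
      refine Finset.sum_eq_zero fun k hk => ?_
      rw [h3 _ (by have := (mem_Icc.1 hk).2; omega), mul_zero]
    rw [hz, show n + 3 - (n + 1) = 2 by omega, show n + 2 + 1 = n + 3 by rfl,
      show n + 3 - (n + 3) = 0 by omega, show n + 1 + 1 = n + 2 by rfl,
      show n + 3 - (n + 2) = 1 by omega, h0, h2] at this
    linear_combination -this
  intro n
  induction n using Nat.strong_induction_on with
  | _ n ih =>
    match n, ih with
    | 0, _ => rw [hs1]; linear_combination hs
    | 1, _ => rw [hs2]; linear_combination (-2) * hp + (α + β - l 1) * hs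
    | (n + 2), ih =>
      rw [hrec, ih (n + 1) (by omega), ih n (by omega)]
      rw [← hp, show l 1 = -(α + β) by rw [hs]; ring]
      ring

lemma exists_ext (F : Type) [Field F] [Fintype F] (n : ℕ) (hn : n ≠ 0) :
    ∃ (K : Type) (_ : Field K) (_ : Fintype K) (_ : Algebra F K), Module.finrank F K = n := by
  obtain ⟨p, hp⟩ := CharP.exists F
  have : Fact (Nat.Prime p) := ⟨CharP.char_is_prime F p⟩
  have : NeZero n := ⟨hn⟩
  exact ⟨FiniteField.Extension F p n, inferInstance, Fintype.ofFinite _, inferInstance,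
    FiniteField.finrank_extension F p n⟩

open Classical in
theorem weil_kloosterman (hF : ringChar F ≠ 2) {ψ : AddChar F ℂ} (hψ : ψ ≠ 1) {a b : F}
    (ha : a ≠ 0) (hb : b ≠ 0) :
    ‖∑ x : F, if x = 0 then 0 else ψ (a * x + b * x⁻¹)‖ ≤ 2 * √(Fintype.card F : ℝ) := by
  set q := Fintype.card F with hq
  set s := sCoeff (kLam ψ a b) with hs
  set l := lCoeff (kLam ψ a b) with hl
  obtain ⟨α, β, hsum, hprod⟩ : ∃ α β : ℂ, α + β = - l 1 ∧ α * β = (q : ℂ) := by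
    obtain ⟨z, hz⟩ := IsAlgClosed.exists_pow_nat_eq (l 1 ^ 2 - 4 * q) (n := 2) (by norm_num)
    refine ⟨(- l 1 + z) / 2, (- l 1 - z) / 2, by ring, ?_⟩
    linear_combination (-1/4) * hz
  have hS := newton_power s l q α β
    (newton_identity (kLam_one ψ a b) (kLam_mul ψ a b)) (lCoeff_zero ψ a b)
    (lCoeff_two hψ ha hb) (fun n hn => lCoeff_ge_three hψ ha hn) hsum hprod
  have hp : (ringChar F).Prime := CharP.char_is_prime F (ringChar F)
  have hp3 : 3 ≤ ringChar F := by
    have := hp.two_le; omega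
  have hq3 : 3 ≤ q := by
    refine hp3.trans ?_
    obtain ⟨n, hn, hc⟩ := FiniteField.card F (ringChar F)
    rw [hq, hc]
    exact Nat.le_self_pow n.pos.ne' _
  have hbd : ∀ k : ℕ, 1 ≤ k → ‖α ^ (2 * (ringChar F * k + 1)) + β ^ (2 * (ringChar F * k + 1))‖ ≤
      7 * (q : ℝ) * (q : ℝ) ^ (ringChar F * k + 1) := by
    intro k hk
    set m := ringChar F * k + 1 with hm
    have hm3 : 3 ≤ m := by nlinarith
    obtain ⟨K, _, _, _, hK⟩ := exists_ext F (2 * m) (by omega)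
    have hchar : ((2 * m : ℕ) : F) ≠ 0 := by
      rw [hm]
      push_cast
      rw [CharP.cast_eq_zero, zero_mul, zero_add, mul_one]
      exact Ring.two_ne_zero hF
    have hlt : Fintype.card F ^ 2 + 3 * Fintype.card F + 1 < Fintype.card F ^ m := by
      rw [← hq]
      calc q ^ 2 + 3 * q + 1 < q ^ 3 := by nlinarith
        _ ≤ q ^ m := Nat.pow_le_pow_right (by omega) hm3
    have := kloo_ext_bound (a := a) (b := b) ha m hK hlt hchar ψ hψ
    rw [← sCoeff_kLam ψ a b, hK, ← hs] at this
    have h2 := hS (2 * m - 1)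
    rw [show 2 * m - 1 + 1 = 2 * m by omega] at h2
    rw [h2, norm_neg] at this
    exact this
  have hq1 : (1 : ℝ) ≤ q := by exact_mod_cast (by omega : 1 ≤ q)
  have hA := weil_power_trick hq1 (by exact_mod_cast hprod) (by omega) hbd
  have hB := weil_power_trick (α := β) (β := α) hq1 (by rw [mul_comm]; exact_mod_cast hprod)
    (by omega : 1 ≤ ringChar F) (fun k hk => by rw [add_comm]; exact hbd k hk)
  have h1 := sCoeff_kLam (K := F) ψ a b
  rw [Module.finrank_self, ← hs] at h1
  have h2 := hS 0
  simp only [zero_add, pow_one] at h2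
  have h3 : ∑ x : F, (if x = 0 then 0 else ψ (a * x + b * x⁻¹)) = -(α + β) := by
    rw [← h2, h1]
    simp only [Algebra.trace_self_apply, smul_eq_mul]
  rw [h3, norm_neg]
  refine (norm_add_le _ _).trans ?_
  linarith

end Weil


section Fourier
open Finset

variable {F : Type} [Field F] [Fintype F]

open Classical in
/-- complex valued quadratic character -/
noncomputable def etaC (F : Type) [Field F] [Fintype F] : MulChar F ℂ :=
  (quadraticChar F).ringHomComp (Int.castRingHom ℂ)

lemma etaC_quad : (etaC F).IsQuadratic := by
  classical
  exact (quadraticChar_isQuadratic F).comp _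

lemma etaC_zero : etaC F 0 = 0 := MulChar.map_zero _

lemma etaC_ne_one (hF : ringChar F ≠ 2) : etaC F ≠ 1 := by
  classical
  exact (MulChar.ringHomComp_ne_one_iff (RingHom.injective_int _)).2 (quadraticChar_ne_one hF)

lemma etaC_sq {a : F} (ha : a ≠ 0) : etaC F a * etaC F a = 1 := by
  classical
  have := quadraticChar_sq_one ha
  simp only [etaC, MulChar.ringHomComp_apply, eq_intCast]
  rw [← pow_two]; exact_mod_cast this

lemma etaC_norm {a : F} (ha : a ≠ 0) : ‖etaC F a‖ = 1 := by
  have h := congrArg norm (etaC_sq ha)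
  rw [norm_mul, norm_one] at h
  nlinarith [norm_nonneg (etaC F a)]

lemma etaC_inv (a : F) : etaC F a⁻¹ = etaC F a := by
  by_cases ha : a = 0
  · simp [ha, etaC_zero]
  · have h1 : etaC F a * etaC F a⁻¹ = 1 := by
      rw [← map_mul, mul_inv_cancel₀ ha, map_one]
    linear_combination (etaC F a) * h1 - (etaC F a⁻¹) * etaC_sq ha

lemma gauss_norm_sq (hF : ringChar F ≠ 2) {ψ : AddChar F ℂ} (hψ : ψ ≠ 1) :
    ‖gaussSum (etaC F) ψ‖ ^ 2 = Fintype.card F := by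
  have h := gaussSum_sq (etaC_ne_one hF) etaC_quad (AddChar.IsPrimitive.of_ne_one hψ)
  rw [← norm_pow, h, norm_mul, etaC_norm (neg_ne_zero.2 one_ne_zero), one_mul, Complex.norm_natCast]

lemma gauss_norm (hF : ringChar F ≠ 2) {ψ : AddChar F ℂ} (hψ : ψ ≠ 1) :
    ‖gaussSum (etaC F) ψ‖ = √(Fintype.card F) := by
  rw [← gauss_norm_sq hF hψ, Real.sqrt_sq (norm_nonneg _)]

lemma sum_shift_zero {ψ : AddChar F ℂ} (hψ : ψ ≠ 1) {u : F} (hu : u ≠ 0) :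
    ∑ y, ψ (u * y) = 0 := by
  classical
  have := AddChar.sum_mulShift u (AddChar.IsPrimitive.of_ne_one hψ)
  rw [if_neg hu] at this
  simpa [mul_comm] using this

lemma quad_gauss (hF : ringChar F ≠ 2) {ψ : AddChar F ℂ} (hψ : ψ ≠ 1) {u : F} (hu : u ≠ 0) :
    ∑ z : F, ψ (u * z ^ 2) = etaC F u * gaussSum (etaC F) ψ := by
  classical
  have h1 : ∑ z : F, ψ (u * z ^ 2) = ∑ y : F, (etaC F y + 1) * ψ (u * y) := by
    rw [← Finset.sum_fiberwise (g := fun z : F => z ^ 2) univ]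
    refine Finset.sum_congr rfl fun y _ => ?_
    rw [Finset.sum_congr rfl (g := fun _ => ψ (u * y))
      (fun x hx => by rw [(mem_filter.1 hx).2]), Finset.sum_const, nsmul_eq_mul]
    congr 1
    have := quadraticChar_card_sqrts hF y
    simp only [etaC, MulChar.ringHomComp_apply, eq_intCast]
    have h2 : ((univ.filter fun z : F => z ^ 2 = y).card : ℤ) = quadraticChar F y + 1 := by
      rw [← this]; congr 2; ext z; simp
    exact_mod_cast congrArg (fun n : ℤ => (n : ℂ)) h2
  rw [h1]
  simp only [add_mul, one_mul, Finset.sum_add_distrib]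
  rw [sum_shift_zero hψ hu, add_zero]
  have h2 := gaussSum_mulShift (etaC F) ψ (Units.mk0 u hu)
  rw [← h2, Units.val_mk0, ← mul_assoc, etaC_sq hu, one_mul, gaussSum]
  rfl

lemma salie_aux (hF : ringChar F ≠ 2) {ψ : AddChar F ℂ} (hψ : ψ ≠ 1) (c : F) :
    ‖∑ u : F, etaC F u * ψ (c * u - u⁻¹)‖ ≤ 2 * √(Fintype.card F : ℝ) := by
  classical
  set G := gaussSum (etaC F) ψ with hG
  set q := Fintype.card F with hq
  have h2 : (2 : F) ≠ 0 := Ring.two_ne_zero hF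
  have h1 : ∀ u : F, u ≠ 0 → ∑ z, ψ (u * (z ^ 2 + c) + 2 * z) = G * (etaC F u * ψ (c * u - u⁻¹)) := by
    intro u hu
    have : ∑ z, ψ (u * (z ^ 2 + c) + 2 * z) = ∑ z, ψ (u * z ^ 2) * ψ (c * u - u⁻¹) := by
      rw [← Equiv.sum_comp (Equiv.addRight (u⁻¹)) (fun z => ψ (u * z ^ 2) * ψ (c * u - u⁻¹))]
      refine Finset.sum_congr rfl fun z _ => ?_
      rw [← AddChar.map_add_eq_mul]
      congr 1
      simp only [Equiv.coe_addRight]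
      field_simp
      ring
    rw [this, ← Finset.sum_mul, quad_gauss hF hψ hu]
    ring
  have h3 : G * ∑ u : F, etaC F u * ψ (c * u - u⁻¹) =
      ∑ z, (if z ^ 2 = -c then (q : ℂ) * ψ (2 * z) else 0) := by
    have e1 : G * ∑ u : F, etaC F u * ψ (c * u - u⁻¹) =
        ∑ u : F, ∑ z, ψ (u * (z ^ 2 + c) + 2 * z) - ∑ z, ψ (2 * z) := by
      rw [Finset.mul_sum, ← Finset.add_sum_erase univ _ (mem_univ (0 : F)),
        ← Finset.add_sum_erase univ (fun u : F => ∑ z, ψ (u * (z ^ 2 + c) + 2 * z)) (mem_univ (0 : F))]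
      rw [← Finset.sum_congr rfl (fun u hu => h1 u (Finset.ne_of_mem_erase hu))]
      simp [etaC_zero]
    rw [e1, sum_shift_zero hψ h2, sub_zero, Finset.sum_comm]
    refine Finset.sum_congr rfl fun z _ => ?_
    simp only [AddChar.map_add_eq_mul]
    rw [← Finset.sum_mul]
    have := AddChar.sum_mulShift (z ^ 2 + c) (AddChar.IsPrimitive.of_ne_one hψ)
    rw [this]
    simp only [← eq_neg_iff_add_eq_zero]
    split_ifs <;> simp [hq]
  have h4 : ‖G * ∑ u : F, etaC F u * ψ (c * u - u⁻¹)‖ ≤ 2 * q := by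
    rw [h3, ← Finset.sum_filter]
    refine (norm_sum_le _ _).trans ?_
    have : ∀ z ∈ univ.filter (fun z : F => z ^ 2 = -c), ‖(q : ℂ) * ψ (2 * z)‖ ≤ q := by
      intro z _
      rw [norm_mul, AddChar.norm_apply, mul_one, Complex.norm_natCast]
    refine (Finset.sum_le_card_nsmul _ _ _ this).trans ?_
    rw [nsmul_eq_mul]
    gcongr
    have hc : ((univ.filter fun z : F => z ^ 2 = -c).card : ℤ) = quadraticChar F (-c) + 1 := by
      rw [← quadraticChar_card_sqrts hF (-c)]; congr 2; ext z; simp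
    have : quadraticChar F (-c) ≤ 1 := by
      rcases quadraticChar_isQuadratic F (-c) with h | h | h <;> rw [h] <;> norm_num
    have : ((univ.filter fun z : F => z ^ 2 = -c).card : ℤ) ≤ 2 := by omega
    exact_mod_cast this
  rw [norm_mul, hG, gauss_norm hF hψ, ← hq] at h4
  have hq0 : 0 < √(q : ℝ) := Real.sqrt_pos.2 (by exact_mod_cast Fintype.card_pos)
  have hqq : √(q : ℝ) * √(q : ℝ) = q := Real.mul_self_sqrt (by positivity)
  refine le_of_mul_le_mul_left (h4.trans (le_of_eq ?_)) hq0
  linear_combination -2 * hqq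

lemma salie (hF : ringChar F ≠ 2) {ψ : AddChar F ℂ} (hψ : ψ ≠ 1) {a : F} (ha : a ≠ 0) (b : F) :
    ‖∑ s : F, etaC F s * ψ (a * s + b * s⁻¹)‖ ≤ 2 * √(Fintype.card F : ℝ) := by
  have hinv : Function.Involutive (fun u : F => -(a * u)⁻¹) := by
    intro u
    by_cases hu : u = 0
    · simp [hu]
    · field_simp
  set e : F ≃ F := hinv.toPerm with he
  rw [← Equiv.sum_comp e (fun s => etaC F s * ψ (a * s + b * s⁻¹))]
  have : ∀ u : F, etaC F (e u) * ψ (a * (e u) + b * (e u)⁻¹) =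
      etaC F (-a) * (etaC F u * ψ (-(a * b) * u - u⁻¹)) := by
    intro u
    simp only [he, Function.Involutive.coe_toPerm]
    by_cases hu : u = 0
    · simp [hu, etaC_zero]
    rw [show -(a * u)⁻¹ = (-a * u)⁻¹ by rw [neg_mul, inv_neg], etaC_inv, map_mul, mul_assoc]
    congr 3
    field_simp
    ring
  simp only [this]
  rw [← Finset.mul_sum, norm_mul, etaC_norm (neg_ne_zero.2 ha), one_mul]
  exact salie_aux hF hψ _

open Classical in
lemma mult_bound (hF : ringChar F ≠ 2) {ψ : AddChar F ℂ} (hψ : ψ ≠ 1) {a : F} (ha : a ≠ 0) (b : F)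
    (d : ℕ) :
    ‖∑ s : F, if s = 0 then 0 else etaC F (-s) ^ d * ψ (a * s + b * s⁻¹)‖ ≤
      2 * √(Fintype.card F : ℝ) := by
  have hm1 : (-1 : F) ≠ 0 := neg_ne_zero.2 one_ne_zero
  rcases Nat.even_or_odd' d with ⟨k, rfl | rfl⟩
  · have : ∀ s : F, (if s = 0 then 0 else etaC F (-s) ^ (2 * k) * ψ (a * s + b * s⁻¹)) =
        if s = 0 then 0 else ψ (a * s + b * s⁻¹) := by
      intro s
      split_ifs with hs
      · rfl
      · rw [pow_mul, pow_two, etaC_sq (neg_ne_zero.2 hs), one_pow, one_mul]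
    simp only [this]
    by_cases hb : b = 0
    · subst hb
      have h1 : ∑ s : F, (if s = 0 then 0 else ψ (a * s + 0 * s⁻¹)) = -1 := by
        have h2 := sum_shift_zero hψ ha
        rw [← Finset.add_sum_erase univ _ (mem_univ (0 : F))] at h2 ⊢
        rw [if_pos rfl, zero_add, Finset.sum_congr rfl (g := fun s => ψ (a * s))
          (fun s hs => by rw [if_neg (Finset.ne_of_mem_erase hs)]; simp)]
        simp only [mul_zero, AddChar.map_zero_eq_one] at h2
        linear_combination h2
      rw [h1, norm_neg, norm_one]
      have : (1 : ℝ) ≤ √(Fintype.card F : ℝ) :=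
        Real.one_le_sqrt.2 (by exact_mod_cast Fintype.card_pos)
      linarith
    · exact weil_kloosterman hF hψ ha hb
  · have : ∀ s : F, (if s = 0 then 0 else etaC F (-s) ^ (2 * k + 1) * ψ (a * s + b * s⁻¹)) =
        etaC F (-1) * (etaC F s * ψ (a * s + b * s⁻¹)) := by
      intro s
      split_ifs with hs
      · simp [hs, etaC_zero]
      · rw [pow_succ, pow_mul, pow_two, etaC_sq (neg_ne_zero.2 hs), one_pow, one_mul,
          show -s = -1 * s by ring, map_mul, mul_assoc]
    simp only [this]
    rw [← Finset.mul_sum, norm_mul, etaC_norm hm1, one_mul]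
    exact salie hF hψ ha b

end Fourier


section Count
open Finset Matrix

variable {F : Type} [Field F] [Fintype F]

lemma addChar_map_sum (ψ : AddChar F ℂ) {d : ℕ} (f : Fin d → F) :
    ψ (∑ i, f i) = ∏ i, ψ (f i) := by
  have := map_prod ψ.toMonoidHom (fun i => Multiplicative.ofAdd (f i)) univ
  rw [← ofAdd_sum] at this
  exact this

lemma vec_gauss (ψ : AddChar F ℂ) (d : ℕ) (u : F) :
    ∑ ξ : Fin d → F, ψ (u * (ξ ⬝ᵥ ξ)) = (∑ z : F, ψ (u * z ^ 2)) ^ d := by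
  have := Finset.prod_univ_sum (fun _ : Fin d => (univ : Finset F)) (fun _ z => ψ (u * z ^ 2))
  rw [Finset.prod_const, Finset.card_univ, Fintype.card_fin, Fintype.piFinset_univ] at this
  rw [this]
  refine Finset.sum_congr rfl fun ξ _ => ?_
  rw [dotProduct, Finset.mul_sum, addChar_map_sum]
  refine Finset.prod_congr rfl fun i _ => ?_
  rw [pow_two]

open Classical in
lemma vec_orth {ψ : AddChar F ℂ} (hψ : ψ ≠ 1) {d : ℕ} (w : Fin d → F) :
    ∑ ξ : Fin d → F, ψ (ξ ⬝ᵥ w) = if w = 0 then (Fintype.card F : ℂ) ^ d else 0 := by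
  have := Finset.prod_univ_sum (fun _ : Fin d => (univ : Finset F)) (fun i z => ψ (w i * z))
  rw [Fintype.piFinset_univ] at this
  have h1 : ∑ ξ : Fin d → F, ψ (ξ ⬝ᵥ w) = ∏ i, ∑ z : F, ψ (w i * z) := by
    rw [this]
    refine Finset.sum_congr rfl fun ξ _ => ?_
    rw [dotProduct, addChar_map_sum]
    simp only [mul_comm]
  rw [h1]
  split_ifs with hw
  · simp [hw]
  · obtain ⟨i, hi⟩ := Function.ne_iff.1 hw
    exact Finset.prod_eq_zero (mem_univ i) (sum_shift_zero hψ hi)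

lemma vec_expand (hF : ringChar F ≠ 2) {ψ : AddChar F ℂ} (hψ : ψ ≠ 1) {d : ℕ} {s : F} (hs : s ≠ 0)
    (w : Fin d → F) :
    gaussSum (etaC F) ψ ^ d * ψ (s * (w ⬝ᵥ w)) =
      etaC F (-s) ^ d * ∑ ξ : Fin d → F, ψ (-(ξ ⬝ᵥ w) + -((ξ ⬝ᵥ ξ) / 4) * s⁻¹) := by
  have h2 : (2 : F) ≠ 0 := Ring.two_ne_zero hF
  have h4 : (4 : F) ≠ 0 := by
    have : (4 : F) = 2 * 2 := by norm_num
    rw [this]; exact mul_ne_zero h2 h2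
  have hu : -(4 * s)⁻¹ ≠ 0 := neg_ne_zero.2 (inv_ne_zero (mul_ne_zero h4 hs))
  have h1 : ∑ ξ : Fin d → F, ψ (-(ξ ⬝ᵥ w) + -((ξ ⬝ᵥ ξ) / 4) * s⁻¹) =
      ψ (s * (w ⬝ᵥ w)) * (etaC F (-s) * gaussSum (etaC F) ψ) ^ d := by
    have e : etaC F (-(4 * s)⁻¹) = etaC F (-s) := by
      rw [show -(4 * s)⁻¹ = (-s * (2 * 2))⁻¹ by rw [← inv_neg]; congr 1; ring, etaC_inv, map_mul,
        map_mul, etaC_sq h2, mul_one]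
    rw [← e, ← quad_gauss hF hψ hu, ← vec_gauss, Finset.mul_sum,
      ← Equiv.sum_comp (Equiv.addRight ((2 * s) • w))
        (fun ξ => ψ (s * (w ⬝ᵥ w)) * ψ (-(4 * s)⁻¹ * (ξ ⬝ᵥ ξ)))]
    refine Finset.sum_congr rfl fun ξ _ => ?_
    rw [← AddChar.map_add_eq_mul]
    congr 1
    simp only [Equiv.coe_addRight, add_dotProduct, dotProduct_add, smul_dotProduct, dotProduct_smul,
      smul_eq_mul]
    rw [dotProduct_comm w ξ]
    field_simp
    ring
  have h3 : etaC F (-s) ^ d * etaC F (-s) ^ d = 1 := by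
    rw [← mul_pow, etaC_sq (neg_ne_zero.2 hs), one_pow]
  rw [h1, mul_pow]
  linear_combination (-(ψ (s * (w ⬝ᵥ w)) * gaussSum (etaC F) ψ ^ d)) * h3

open Classical in
theorem count_bound (hF : ringChar F ≠ 2) (d : ℕ) {t : F} (ht : t ≠ 0) (A : Finset (Fin d → F)) :
    |(Fintype.card F : ℝ) * (((A ×ˢ A).filter
                (fun p : (Fin d → F) × (Fin d → F) =>
                  (p.1 - p.2) ⬝ᵥ (p.1 - p.2) = t)).card : ℝ) - (A.card : ℝ) ^ 2| ≤
      2 * √(Fintype.card F : ℝ) * √(Fintype.card F : ℝ) ^ d * A.card := by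
  obtain ⟨ψ, hψ⟩ : ∃ ψ : AddChar F ℂ, ψ ≠ 1 := by
    obtain ⟨ψ, h⟩ := AddChar.exists_apply_ne_zero.2 (one_ne_zero : (1 : F) ≠ 0)
    exact ⟨ψ, fun hh => h (by rw [hh]; simp)⟩
  set q := Fintype.card F with hq
  set N := ((A ×ˢ A).filter
                (fun p : (Fin d → F) × (Fin d → F) =>
                  (p.1 - p.2) ⬝ᵥ (p.1 - p.2) = t)).card with hN
  set G := gaussSum (etaC F) ψ with hG
  set a : (Fin d → F) → ℂ := fun ξ => ∑ x ∈ A, ψ (ξ ⬝ᵥ x) with ha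
  set R : ℂ := ∑ s : F, if s = 0 then 0 else
    ∑ p ∈ A ×ˢ A, ψ (s * ((p.1 - p.2) ⬝ᵥ (p.1 - p.2) - t)) with hR
  have hqN : (q : ℂ) * N = (A.card : ℂ) ^ 2 + R := by
    have h1 : (q : ℂ) * N = ∑ p ∈ A ×ˢ A, ∑ s : F, ψ (s * ((p.1 - p.2) ⬝ᵥ (p.1 - p.2) - t)) := by
      rw [hN, Finset.card_filter]
      push_cast
      rw [Finset.mul_sum]
      refine Finset.sum_congr rfl fun p _ => ?_
      rw [AddChar.sum_mulShift _ (AddChar.IsPrimitive.of_ne_one hψ)]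
      simp only [sub_eq_zero]
      split_ifs <;> simp [hq]
    rw [h1, Finset.sum_comm, hR, ← Finset.add_sum_erase univ _ (mem_univ (0 : F)),
      ← Finset.add_sum_erase (a := (0 : F)) univ (fun s : F => if s = 0 then 0 else
        ∑ p ∈ A ×ˢ A, ψ (s * ((p.1 - p.2) ⬝ᵥ (p.1 - p.2) - t))) (mem_univ (0 : F)),
      if_pos rfl, zero_add]
    congr 1
    · simp [pow_two]
    · refine Finset.sum_congr rfl fun s hs => ?_
      rw [if_neg (Finset.ne_of_mem_erase hs)]
  have hP : ∀ ξ, ∑ p ∈ A ×ˢ A, ψ (-(ξ ⬝ᵥ (p.1 - p.2))) = ((‖a ξ‖ ^ 2 : ℝ) : ℂ) := by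
    intro ξ
    rw [← Complex.normSq_eq_norm_sq, Complex.normSq_eq_conj_mul_self, ha, map_sum,
      Finset.sum_mul_sum, Finset.sum_product]
    refine Finset.sum_congr rfl fun x _ => Finset.sum_congr rfl fun y _ => ?_
    rw [← AddChar.map_neg_eq_conj, ← AddChar.map_add_eq_mul]
    congr 1
    rw [dotProduct_sub]; ring
  have hPl : ∑ ξ, ‖a ξ‖ ^ 2 = (q : ℝ) ^ d * A.card := by
    have h1 : ((∑ ξ, ‖a ξ‖ ^ 2 : ℝ) : ℂ) = (q : ℂ) ^ d * A.card := by
      rw [Complex.ofReal_sum, ← Finset.sum_congr rfl (fun ξ _ => hP ξ), Finset.sum_comm,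
        Finset.sum_product]
      have : ∀ x ∈ A, ∑ y ∈ A, ∑ ξ : Fin d → F, ψ (-(ξ ⬝ᵥ (x - y))) = (q : ℂ) ^ d := by
        intro x hx
        have h2 : ∀ y, ∑ ξ : Fin d → F, ψ (-(ξ ⬝ᵥ (x - y))) = if y = x then (q : ℂ) ^ d else 0 := by
          intro y
          have h3 := vec_orth hψ (y - x)
          rw [← hq] at h3
          simp only [sub_eq_zero] at h3
          rw [← h3]
          refine Finset.sum_congr rfl fun ξ _ => ?_
          congr 1
          rw [dotProduct_sub, dotProduct_sub]; ring
        simp only [h2]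
        rw [Finset.sum_ite_eq', if_pos hx]
      rw [Finset.sum_congr rfl this]
      simp [mul_comm]
    exact_mod_cast h1
  have hGR : G ^ d * R = ∑ ξ : Fin d → F, ((‖a ξ‖ ^ 2 : ℝ) : ℂ) *
      ∑ s : F, if s = 0 then 0 else etaC F (-s) ^ d * ψ (-t * s + -((ξ ⬝ᵥ ξ) / 4) * s⁻¹) := by
    simp only [← hP, hR, Finset.mul_sum]
    rw [Finset.sum_comm]
    refine Finset.sum_congr rfl fun s _ => ?_
    by_cases hs : s = 0
    · simp [hs]
    simp only [if_neg hs]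
    simp only [Finset.sum_mul, Finset.mul_sum]
    rw [Finset.sum_comm]
    refine Finset.sum_congr rfl fun p _ => ?_
    have := vec_expand hF hψ hs (p.1 - p.2)
    rw [show s * ((p.1 - p.2) ⬝ᵥ (p.1 - p.2) - t) = s * ((p.1 - p.2) ⬝ᵥ (p.1 - p.2)) + -t * s by ring,
      AddChar.map_add_eq_mul, ← mul_assoc, this, Finset.mul_sum, Finset.sum_mul]
    refine Finset.sum_congr rfl fun ξ _ => ?_
    simp only [AddChar.map_add_eq_mul]
    ring
  have hq0 : 0 < √(q : ℝ) := Real.sqrt_pos.2 (by exact_mod_cast Fintype.card_pos)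
  have hqq : √(q : ℝ) * √(q : ℝ) = q := Real.mul_self_sqrt (by positivity)
  have hbound : ‖G ^ d * R‖ ≤ (q : ℝ) ^ d * A.card * (2 * √(q : ℝ)) := by
    rw [hGR, ← hPl, Finset.sum_mul]
    refine (norm_sum_le _ _).trans (Finset.sum_le_sum fun ξ _ => ?_)
    rw [norm_mul, Complex.norm_real, Real.norm_of_nonneg (by positivity)]
    exact mul_le_mul_of_nonneg_left (mult_bound hF hψ (neg_ne_zero.2 ht) _ d) (by positivity)
  rw [norm_mul, norm_pow, hG, gauss_norm hF hψ, ← hq] at hbound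
  have hR2 : ‖R‖ = |(q : ℝ) * N - (A.card : ℝ) ^ 2| := by
    rw [← Real.norm_eq_abs, ← Complex.norm_real]
    congr 1
    push_cast
    linear_combination -hqN
  rw [← hR2]
  refine le_of_mul_le_mul_left (hbound.trans (le_of_eq ?_)) (pow_pos hq0 d)
  have : (q : ℝ) ^ d = √(q : ℝ) ^ d * √(q : ℝ) ^ d := by rw [← mul_pow, hqq]
  rw [this]; ring

end Count

open Matrix Finset
open scoped Classical

/-- Distance count (the `k = 1` full-rank case of the main theorem): for
`d ≥ 3` and `t ≠ 0`, the number of ordered pairs of points of `A` at distance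
`t` is `α² q^{2d-1} + O(α q^{(3d-1)/2})`; in particular a set of density
`α ≥ C q^{-(d-1)/2}` contains two distinct points `x, y` with `|x - y|² = t`. -/
theorem distance_pair_count :
    ∃ C : ℝ, 0 < C ∧
      ∀ (F : Type) [Field F] [Fintype F],
        ringChar F ≠ 2 →
        ∀ d : ℕ, 3 ≤ d →
        ∀ t : F, t ≠ 0 →
        ∀ (A : Finset (Fin d → F)) (α : ℝ),
          (A.card : ℝ) = α * (Fintype.card F : ℝ) ^ d →
          (∃ E : ℝ,
            (((A ×ˢ A).filter
                (fun p : (Fin d → F) × (Fin d → F) =>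
                  (p.1 - p.2) ⬝ᵥ (p.1 - p.2) = t)).card : ℝ) =
              α ^ 2 * (Fintype.card F : ℝ) ^ (2 * d - 1) + E ∧
            |E| ≤ C * α * (Fintype.card F : ℝ) ^ ((3 * (d : ℝ) - 1) / 2)) ∧
          (C * (Fintype.card F : ℝ) ^ (-(((d : ℝ) - 1) / 2)) ≤ α →
            ∃ x ∈ A, ∃ y ∈ A, x ≠ y ∧ (x - y) ⬝ᵥ (x - y) = t) := by

  refine ⟨3, by norm_num, ?_⟩
  intro F _ _ hF d hd t ht A α hα
  have hb := count_bound hF d ht A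
  set N : ℝ := (((A ×ˢ A).filter
                (fun p : (Fin d → F) × (Fin d → F) =>
                  (p.1 - p.2) ⬝ᵥ (p.1 - p.2) = t)).card : ℝ) with hN
  set q : ℝ := (Fintype.card F : ℝ) with hq
  have hq0 : 0 < q := by rw [hq]; exact_mod_cast Fintype.card_pos
  have hα0 : 0 ≤ α := by
    have h1 : 0 ≤ α * q ^ d := by rw [← hα]; positivity
    exact nonneg_of_mul_nonneg_left h1 (pow_pos hq0 d)
  have hpow : (q : ℝ) ^ (2 * d) = q * q ^ (2 * d - 1) := by
    rw [← pow_succ']; congr 1; omega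
  set Q : ℝ := q ^ ((3 * (d : ℝ) - 1) / 2) with hQ
  have hQ0 : 0 < Q := Real.rpow_pos_of_pos hq0 _
  have hQe : √q * √q ^ d * q ^ d = q * Q := by
    rw [Real.sqrt_eq_rpow, ← Real.rpow_natCast, ← Real.rpow_natCast, ← Real.rpow_mul hq0.le,
      ← Real.rpow_add hq0, ← Real.rpow_add hq0, hQ]
    nth_rewrite 2 [← Real.rpow_one q]
    rw [← Real.rpow_add hq0]
    congr 1
    ring
  set E : ℝ := N - α ^ 2 * q ^ (2 * d - 1) with hE
  have hEb : |E| ≤ 2 * α * Q := by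
    have h1 : q * N - (A.card : ℝ) ^ 2 = q * E := by
      rw [hα, hE, mul_pow, ← pow_mul, mul_comm d 2, hpow]; ring
    rw [h1, abs_mul, abs_of_pos hq0, hα] at hb
    refine le_of_mul_le_mul_left (hb.trans (le_of_eq ?_)) hq0
    linear_combination 2 * α * hQe
  refine ⟨⟨E, by rw [hE]; ring, ?_⟩, ?_⟩
  · nlinarith [mul_nonneg hα0 hQ0.le]
  · intro hαC
    have hr : 0 < q ^ (-(((d : ℝ) - 1) / 2)) := Real.rpow_pos_of_pos hq0 _
    have hαp : 0 < α := by linarith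
    have h3 : q ^ (-(((d : ℝ) - 1) / 2)) * q ^ (2 * d - 1) = Q := by
      rw [← Real.rpow_natCast, ← Real.rpow_add hq0, hQ]
      congr 1
      rw [Nat.cast_sub (by omega)]
      push_cast
      ring
    have h4 : 3 * Q ≤ α * q ^ (2 * d - 1) := by
      have := mul_le_mul_of_nonneg_right hαC (pow_pos hq0 (2 * d - 1)).le
      rw [mul_assoc, h3] at this
      exact this
    have hNpos : 0 < N := by
      have h5 := (abs_le.1 hEb).1
      have h6 := mul_le_mul_of_nonneg_left h4 hα0
      have h7 := mul_pos hαp hQ0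
      have : N = α * (α * q ^ (2 * d - 1)) + E := by rw [hE]; ring
      rw [this]
      nlinarith
    have hNpos' := Finset.card_pos.1 (Nat.cast_pos.1 (hN ▸ hNpos))
    obtain ⟨⟨x, y⟩, hp⟩ := hNpos'
    obtain ⟨hxy, hdist⟩ := Finset.mem_filter.1 hp
    obtain ⟨hx, hy⟩ := Finset.mem_product.1 hxy
    refine ⟨x, hx, y, hy, ?_, hdist⟩
    rintro rfl
    simp at hdist
    exact ht hdist.symm
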